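/- Let F be the free group on a set S, let w ∈ F, and let G = F/⟪w⟫ be the associated one-relator group. Then there exist an element r ∈ F whose reduced length is at most that of w and an integer k ≥ 1 such that w ∈ r^k·[⟪r⟫, ⟪r⟫] (where ⟪r⟫ is the normal closure of r in F), and the ω-th term D^ω(G) of the rational derived series of G equals the normal closure in G of the image of r; moreover this subgroup is rationally perfect, i.e. D^1(D^ω(G)) = D^ω(G). -/

import Mathlib

def ratDerived (G : Type*) [Group G] : ℕ → Subgroup G
  | 0 => ⊤
  | i + 1 =>
      Subgroup.closure
        {g | g ∈ ratDerived G i ∧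
          ∃ k : ℕ, 1 ≤ k ∧ g ^ k ∈ ⁅ratDerived G i, ratDerived G i⁆}

instance ratDerived_normal (G : Type*) [Group G] (i : ℕ) : (ratDerived G i).Normal := by
  induction i with
  | zero =>
    show (⊤ : Subgroup G).Normal
    infer_instance
  | succ i ih =>
    haveI := ih
    constructor
    intro x hx g
    have himg : (fun y => g * y * g⁻¹) ''
        {y | y ∈ ratDerived G i ∧ ∃ k : ℕ, 1 ≤ k ∧ y ^ k ∈ ⁅ratDerived G i, ratDerived G i⁆} ⊆
        {y | y ∈ ratDerived G i ∧ ∃ k : ℕ, 1 ≤ k ∧ y ^ k ∈ ⁅ratDerived G i, ratDerived G i⁆} := by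
      rintro _ ⟨y, ⟨hy, k, hk, hyk⟩, rfl⟩
      refine ⟨ih.conj_mem y hy g, k, hk, ?_⟩
      rw [conj_pow]
      exact (Subgroup.commutator_normal _ _).conj_mem _ hyk g
    have hmap : (ratDerived G (i + 1)).map (MulAut.conj g).toMonoidHom ≤ ratDerived G (i + 1) := by
      show (Subgroup.closure _).map _ ≤ Subgroup.closure _
      rw [MonoidHom.map_closure]
      refine (Subgroup.closure_le _).2 (fun y hy => Subgroup.subset_closure (himg ?_))
      simpa using hy
    exact hmap ⟨x, hx, rfl⟩

def ratDerivedOmega (G : Type*) [Group G] : Subgroup G := ⨅ i, ratDerived G i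

instance ratDerivedOmega_normal (G : Type*) [Group G] : (ratDerivedOmega G).Normal := by
  constructor
  intro x hx g
  simp only [ratDerivedOmega, Subgroup.mem_iInf] at hx ⊢
  exact fun i => (ratDerived_normal G i).conj_mem x (hx i) g

def QSolvable (G : Type*) [Group G] : Prop := ∃ n : ℕ, ratDerived G n = ⊥

def ResiduallyQSolvable (G : Type*) [Group G] : Prop := ratDerivedOmega G = ⊥

namespace RatDerived

section Basic

variable {G : Type*} [Group G]

lemma mul_pow_mem (D : Subgroup G) [D.Normal] {M : Subgroup G} (hM : ⁅D, D⁆ ≤ M) {x y : G}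
    (hx : x ∈ D) (hy : y ∈ D) {k : ℕ} (hxk : x ^ k ∈ M) (hyk : y ^ k ∈ M) : (x * y) ^ k ∈ M := by
  have h : (x * y) ^ k * (x ^ k * y ^ k)⁻¹ ∈ ⁅D, D⁆ := by
    rw [← QuotientGroup.eq_one_iff]
    have hc : Commute (x : G ⧸ ⁅D, D⁆) (y : G ⧸ ⁅D, D⁆) := by
      rw [commute_iff_eq, ← mul_inv_eq_one, mul_inv_rev, ← mul_assoc]
      have := (QuotientGroup.eq_one_iff (N := ⁅D, D⁆) _).2 (Subgroup.commutator_mem_commutator hx hy)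
      simpa [commutatorElement_def] using this
    simp [hc.mul_pow]
  exact (Subgroup.mul_mem_cancel_right M (M.inv_mem (M.mul_mem hxk hyk))).1 (hM h)

/-- Elements of `D` having a positive power in `M`. -/
def isolator (D : Subgroup G) [D.Normal] (M : Subgroup G) (hM : ⁅D, D⁆ ≤ M) : Subgroup G where
  carrier := {g | g ∈ D ∧ ∃ k : ℕ, 1 ≤ k ∧ g ^ k ∈ M}
  one_mem' := ⟨D.one_mem, 1, le_rfl, by simp⟩
  mul_mem' := by
    rintro x y ⟨hx, k, hk, hxk⟩ ⟨hy, l, hl, hyl⟩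
    refine ⟨D.mul_mem hx hy, k * l, Nat.mul_pos hk hl, mul_pow_mem D hM hx hy ?_ ?_⟩
    · rw [pow_mul]; exact M.pow_mem hxk l
    · rw [mul_comm, pow_mul]; exact M.pow_mem hyl k
  inv_mem' := by
    rintro x ⟨hx, k, hk, hxk⟩
    exact ⟨D.inv_mem hx, k, hk, by rw [inv_pow]; exact M.inv_mem hxk⟩

lemma mem_isolator {D : Subgroup G} [D.Normal] {M : Subgroup G} {hM : ⁅D, D⁆ ≤ M} {g : G} :
    g ∈ isolator D M hM ↔ g ∈ D ∧ ∃ k : ℕ, 1 ≤ k ∧ g ^ k ∈ M := Iff.rfl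

instance isolator_normal (D : Subgroup G) [D.Normal] (M : Subgroup G) [hMn : M.Normal]
    (hM : ⁅D, D⁆ ≤ M) : (isolator D M hM).Normal := by
  constructor
  rintro x ⟨hx, k, hk, hxk⟩ g
  exact ⟨Subgroup.Normal.conj_mem ‹_› x hx g, k, hk, by
    rw [conj_pow]; exact hMn.conj_mem _ hxk g⟩

lemma mem_ratDerived_succ {i : ℕ} {g : G} :
    g ∈ ratDerived G (i + 1) ↔
      g ∈ ratDerived G i ∧ ∃ k : ℕ, 1 ≤ k ∧ g ^ k ∈ ⁅ratDerived G i, ratDerived G i⁆ := by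
  change g ∈ Subgroup.closure (isolator (ratDerived G i) _ le_rfl : Set G) ↔ _
  rw [Subgroup.closure_eq, mem_isolator]

/-- The preimage in `G` of the `i`-th rational derived subgroup of `G ⧸ K`. -/
def pre (K : Subgroup G) [K.Normal] (i : ℕ) : Subgroup G :=
  (ratDerived (G ⧸ K) i).comap (QuotientGroup.mk' K)

instance pre_normal (K : Subgroup G) [K.Normal] (i : ℕ) : (pre K i).Normal :=
  Subgroup.Normal.comap (ratDerived_normal _ i) _

instance iInf_pre_normal (K : Subgroup G) [K.Normal] : (⨅ i, pre K i).Normal :=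
  Subgroup.normal_iInf_normal fun i => pre_normal K i

variable {K : Subgroup G} [K.Normal]

lemma pre_zero : pre K 0 = ⊤ := by
  simp [pre, ratDerived]

lemma mem_pre_succ {i : ℕ} {u : G} :
    u ∈ pre K (i + 1) ↔ u ∈ pre K i ∧ ∃ k : ℕ, 1 ≤ k ∧ u ^ k ∈ ⁅pre K i, pre K i⁆ ⊔ K := by
  have h : ⁅pre K i, pre K i⁆ ⊔ K =
      (⁅ratDerived (G ⧸ K) i, ratDerived (G ⧸ K) i⁆).comap (QuotientGroup.mk' K) := by
    have h1 : (pre K i).map (QuotientGroup.mk' K) = ratDerived (G ⧸ K) i :=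
      Subgroup.map_comap_eq_self_of_surjective (QuotientGroup.mk'_surjective K) _
    rw [← h1, ← Subgroup.map_commutator, Subgroup.comap_map_eq, QuotientGroup.ker_mk']
  simp only [h, Subgroup.mem_comap, map_pow]
  exact mem_ratDerived_succ

lemma pre_succ_le (i : ℕ) : pre K (i + 1) ≤ pre K i := fun _ h => (mem_pre_succ.1 h).1

lemma pre_antitone : Antitone (pre K) := antitone_nat_of_succ_le pre_succ_le

lemma le_pre (i : ℕ) : K ≤ pre K i := by
  intro x hx
  have : (QuotientGroup.mk' K) x = 1 := (QuotientGroup.eq_one_iff x).2 hx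
  rw [pre, Subgroup.mem_comap, this]
  exact Subgroup.one_mem _

lemma commutator_sup_le (i : ℕ) : ⁅pre K i, pre K i⁆ ⊔ K ≤ pre K (i + 1) := by
  intro x hx
  refine mem_pre_succ.2 ⟨?_, 1, le_rfl, by simpa using hx⟩
  exact sup_le (Subgroup.commutator_le_left _ _) (le_pre i) hx

lemma mem_pre_succ_of_pow {i : ℕ} {u : G} (hu : u ∈ pre K i) {k : ℕ} (hk : 1 ≤ k)
    (h : u ^ k ∈ pre K (i + 1)) : u ∈ pre K (i + 1) := by
  obtain ⟨-, l, hl, hul⟩ := mem_pre_succ.1 h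
  exact mem_pre_succ.2 ⟨hu, k * l, Nat.mul_pos hk hl, by rwa [pow_mul]⟩

lemma sup_normalClosure_le_of_pow {P : Subgroup G} [P.Normal] {w r : G} {k : ℕ}
    (hw : (r ^ k)⁻¹ * w ∈ P) :
    P ⊔ Subgroup.normalClosure {w} ≤ P ⊔ Subgroup.normalClosure {r} := by
  have h1 : r ^ k ∈ Subgroup.normalClosure {r} :=
    Subgroup.pow_mem _ (Subgroup.subset_normalClosure (Set.mem_singleton r)) k
  have h2 : w ∈ P ⊔ Subgroup.normalClosure {r} := by
    rw [← mul_inv_cancel_left (r ^ k) w]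
    refine Subgroup.mul_mem _ ?_ ?_
    · exact Subgroup.mem_sup_right h1
    · exact Subgroup.mem_sup_left hw
  exact sup_le le_sup_left (Subgroup.normalClosure_le_normal (Set.singleton_subset_iff.2 h2))

lemma pre_eq_of_pow_mem {w r : G} {k : ℕ}
    (hr : ∀ i, r ∈ pre (Subgroup.normalClosure {w}) i)
    (hw : ∀ i, (r ^ k)⁻¹ * w ∈
      ⁅pre (Subgroup.normalClosure {w}) i, pre (Subgroup.normalClosure {w}) i⁆) (i : ℕ) :
    pre (Subgroup.normalClosure {r}) i = pre (Subgroup.normalClosure {w}) i := by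
  induction i with
  | zero => simp [pre_zero]
  | succ i ih =>
    ext u
    constructor
    · intro hu
      rw [mem_pre_succ, ih] at hu
      obtain ⟨hu, m, hm, hum⟩ := hu
      refine mem_pre_succ_of_pow hu hm ?_
      refine (sup_le ?_ ?_ : _ ≤ pre (Subgroup.normalClosure {w}) (i + 1)) hum
      · exact le_sup_left.trans (commutator_sup_le i)
      · exact Subgroup.normalClosure_le_normal (by simpa using hr (i + 1))
    · intro hu
      rw [mem_pre_succ] at hu ⊢
      rw [ih]
      obtain ⟨hu, m, hm, hum⟩ := hu
      exact ⟨hu, m, hm, sup_normalClosure_le_of_pow (hw i) hum⟩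

end Basic

end RatDerived

namespace RatDerived

open scoped commutatorElement

/-- A decreasing multiplicative filtration of an algebra which is eventually zero. -/
structure NilFiltration (A : Type*) [Ring A] [Algebra ℚ A] where
  /-- The terms of the filtration. -/
  I : ℕ → Submodule ℚ A
  anti : Antitone I
  I_mul : ∀ {i j : ℕ} {a b : A}, a ∈ I i → b ∈ I j → a * b ∈ I (i + j)
  /-- An index at which the filtration vanishes. -/
  N : ℕ
  one_le : 1 ≤ N
  eq_bot : I N = ⊥

namespace NilFiltration

variable {A : Type*} [Ring A] [Algebra ℚ A] (Φ : NilFiltration A)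

lemma mul_mem_of_le {i j k : ℕ} {a b : A} (ha : a ∈ Φ.I i) (hb : b ∈ Φ.I j) (h : k ≤ i + j) :
    a * b ∈ Φ.I k := Φ.anti h (Φ.I_mul ha hb)

/-- The congruence subgroups of the filtration. -/
def U (k : ℕ) : Subgroup Aˣ where
  carrier := {u | (u : A) - 1 ∈ Φ.I k ∧ ((u⁻¹ : Aˣ) : A) - 1 ∈ Φ.I k}
  one_mem' := by simp
  mul_mem' := by
    rintro u v ⟨hu, hu'⟩ ⟨hv, hv'⟩
    have key : ∀ {a b : A}, a - 1 ∈ Φ.I k → b - 1 ∈ Φ.I k → a * b - 1 ∈ Φ.I k := by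
      intro a b ha hb
      have : a * b - 1 = (a - 1) * (b - 1) + ((a - 1) + (b - 1)) := by noncomm_ring
      rw [this]
      exact add_mem (Φ.mul_mem_of_le ha hb (by omega)) (add_mem ha hb)
    refine ⟨?_, ?_⟩
    · rw [Units.val_mul]; exact key hu hv
    · rw [mul_inv_rev, Units.val_mul]; exact key hv' hu'
  inv_mem' := by
    rintro u ⟨hu, hu'⟩
    exact ⟨hu', by simpa using hu⟩

lemma U_anti : Antitone Φ.U := fun _ _ h _ hu => ⟨Φ.anti h hu.1, Φ.anti h hu.2⟩

lemma pow_mem_of_one_le {k : ℕ} {n : A} (hn : n ∈ Φ.I k) {j : ℕ} (hj : 1 ≤ j) :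
    n ^ j ∈ Φ.I (k * j) := by
  induction j, hj using Nat.le_induction with
  | base => simpa using hn
  | succ j hj ih => rw [pow_succ, Nat.mul_succ]; exact Φ.I_mul ih hn

lemma pow_N_eq_zero {k : ℕ} (hk : 1 ≤ k) {n : A} (hn : n ∈ Φ.I k) : n ^ Φ.N = 0 := by
  have h := Φ.anti (Nat.le_mul_of_pos_left Φ.N hk) (Φ.pow_mem_of_one_le hn Φ.one_le)
  rwa [Φ.eq_bot, Submodule.mem_bot] at h

lemma mem_U_of_sub_mem {k : ℕ} (hk : 1 ≤ k) {u : Aˣ} (hu : (u : A) - 1 ∈ Φ.I k) : u ∈ Φ.U k := by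
  refine ⟨hu, ?_⟩
  set n : A := -((u : A) - 1) with hn
  set v : A := ((u⁻¹ : Aˣ) : A) with hv
  have hnI : n ∈ Φ.I k := neg_mem hu
  have hv1 : v = 1 + n * v := by
    have : (u : A) * v = 1 := by simp [hv]
    rw [hn, neg_sub, sub_mul, one_mul, this]; abel
  have claim : ∀ j, 1 ≤ j → ∃ p ∈ Φ.I k, v = 1 + p + n ^ j * v := by
    intro j hj
    induction j, hj using Nat.le_induction with
    | base => exact ⟨0, zero_mem _, by simpa using hv1⟩
    | succ j hj ih =>
      obtain ⟨p, hp, hpv⟩ := ih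
      refine ⟨p + n ^ j, add_mem hp (Φ.anti (Nat.le_mul_of_pos_right k hj)
        (Φ.pow_mem_of_one_le hnI hj)), ?_⟩
      have h2 : n ^ j * v = n ^ j + n ^ (j + 1) * v := by
        nth_rewrite 1 [hv1]
        rw [mul_add, mul_one, pow_succ, mul_assoc]
      nth_rewrite 1 [hpv]
      rw [h2]; abel
  obtain ⟨p, hp, hpv⟩ := claim Φ.N Φ.one_le
  rw [Φ.pow_N_eq_zero hk hnI, zero_mul, add_zero] at hpv
  rw [hpv]; simpa using hp

lemma exists_unit {k : ℕ} (hk : 1 ≤ k) {n : A} (hn : n ∈ Φ.I k) :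
    ∃ u : Aˣ, (u : A) = 1 + n ∧ u ∈ Φ.U k := by
  obtain ⟨u, hu⟩ := IsNilpotent.isUnit_one_add ⟨Φ.N, Φ.pow_N_eq_zero hk hn⟩
  exact ⟨u, hu, Φ.mem_U_of_sub_mem hk (by simpa [hu] using hn)⟩

lemma mul_sub_mem {k : ℕ} {x b : A} (hx : x ∈ Φ.I k) (hb : b - 1 ∈ Φ.I 1) :
    x * b - x ∈ Φ.I (k + 1) := by
  have : x * b - x = x * (b - 1) := by noncomm_ring
  rw [this]; exact Φ.I_mul hx hb

lemma mul_sub_mem' {k : ℕ} {x b : A} (hx : x ∈ Φ.I k) (hb : b - 1 ∈ Φ.I 1) :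
    b * x - x ∈ Φ.I (k + 1) := by
  have : b * x - x = (b - 1) * x := by noncomm_ring
  rw [this, add_comm]; exact Φ.I_mul hb hx

lemma mul_mem_right {k : ℕ} {x b : A} (hx : x ∈ Φ.I k) (hb : b - 1 ∈ Φ.I 1) : x * b ∈ Φ.I k := by
  have := add_mem (Φ.anti (Nat.le_succ k) (Φ.mul_sub_mem hx hb)) hx
  rwa [sub_add_cancel] at this

lemma mul_mem_left {k : ℕ} {x b : A} (hx : x ∈ Φ.I k) (hb : b - 1 ∈ Φ.I 1) : b * x ∈ Φ.I k := by
  have := add_mem (Φ.anti (Nat.le_succ k) (Φ.mul_sub_mem' hx hb)) hx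
  rwa [sub_add_cancel] at this

lemma commutator_mem {k : ℕ} (hk : 1 ≤ k) {g h : Aˣ} (hg : g ∈ Φ.U k) (hh : h ∈ Φ.U k) :
    ⁅g, h⁆ ∈ Φ.U (k + 1) := by
  refine Φ.mem_U_of_sub_mem (by omega) ?_
  have e : ((⁅g, h⁆ : Aˣ) : A) - 1 =
      (((g : A) - 1) * (h - 1) - (h - 1) * (g - 1)) * ((g⁻¹ : Aˣ) : A) * ((h⁻¹ : Aˣ) : A) := by
    have h1 : ((g : A) - 1) * (h - 1) - (h - 1) * (g - 1) = g * h - h * g := by noncomm_ring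
    rw [h1, sub_mul, sub_mul, commutatorElement_def]
    simp
  rw [e]
  refine Φ.mul_mem_right (Φ.mul_mem_right (sub_mem ?_ ?_) (Φ.U_anti hk hg).2) (Φ.U_anti hk hh).2
  · exact Φ.mul_mem_of_le hg.1 hh.1 (by omega)
  · exact Φ.mul_mem_of_le hh.1 hg.1 (by omega)

lemma pow_sub_mem {k : ℕ} (hk : 1 ≤ k) {a : A} (ha : a - 1 ∈ Φ.I k) (m : ℕ) :
    a ^ m - 1 - (m : ℚ) • (a - 1) ∈ Φ.I (k + 1) := by
  induction m with
  | zero => simp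
  | succ m ih =>
    have : a ^ (m + 1) - 1 - ((m + 1 : ℕ) : ℚ) • (a - 1) =
        (a ^ m - 1 - (m : ℚ) • (a - 1)) * a + (m : ℚ) • ((a - 1) * a - (a - 1)) := by
      push_cast
      simp only [pow_succ, add_smul, one_smul, sub_mul, smul_mul_assoc, one_mul, smul_sub]
      abel
    rw [this]
    have ha1 := Φ.anti hk ha
    exact add_mem (Φ.mul_mem_right ih ha1) (Submodule.smul_mem _ _ (Φ.mul_sub_mem ha ha1))

lemma mem_U_of_pow_mem {k : ℕ} (hk : 1 ≤ k) {u : Aˣ} (hu : u ∈ Φ.U k) {m : ℕ} (hm : 1 ≤ m)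
    (h : u ^ m ∈ Φ.U (k + 1)) : u ∈ Φ.U (k + 1) := by
  refine Φ.mem_U_of_sub_mem (by omega) ?_
  have h1 := sub_mem h.1 (Φ.pow_sub_mem hk hu.1 m)
  rw [Units.val_pow_eq_pow_val, sub_sub_cancel] at h1
  have hm' : (m : ℚ) ≠ 0 := by positivity
  have h2 := Submodule.smul_mem _ ((m : ℚ)⁻¹) h1
  rwa [smul_smul, inv_mul_cancel₀ hm', one_smul] at h2

lemma U_N {u : Aˣ} (hu : u ∈ Φ.U Φ.N) : u = 1 := by
  have h := hu.1
  rw [Φ.eq_bot, Submodule.mem_bot, sub_eq_zero] at h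
  exact Units.ext h

lemma mem_U_of_mem_pre {G : Type*} [Group G] {K : Subgroup G} [K.Normal] {n : ℕ}
    (φ : pre K n →* Aˣ) (h1 : ∀ u, φ u ∈ Φ.U 1) (hK : ∀ u : pre K n, (u : G) ∈ K → φ u = 1)
    (j : ℕ) (u : pre K n) (hu : (u : G) ∈ pre K (n + j)) : φ u ∈ Φ.U (j + 1) := by
  induction j generalizing u with
  | zero => exact h1 u
  | succ j ih =>
    have hle : ⁅pre K (n + j), pre K (n + j)⁆ ⊔ K ≤
        ((Φ.U (j + 1 + 1)).comap φ).map (pre K n).subtype := by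
      refine sup_le (Subgroup.commutator_le.2 fun g hg h hh => ?_) fun g hg => ?_
      · have hg' := pre_antitone (Nat.le_add_right n j) hg
        have hh' := pre_antitone (Nat.le_add_right n j) hh
        refine ⟨⁅(⟨g, hg'⟩ : pre K n), ⟨h, hh'⟩⁆, ?_, rfl⟩
        simp only [SetLike.mem_coe, Subgroup.mem_comap, map_commutatorElement]
        exact Φ.commutator_mem (by omega) (ih _ hg) (ih _ hh)
      · refine ⟨⟨g, le_pre n hg⟩, ?_, rfl⟩
        simp only [SetLike.mem_coe, Subgroup.mem_comap, hK ⟨g, le_pre n hg⟩ hg, one_mem]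
    obtain ⟨hu1, k, hk, huk⟩ := mem_pre_succ.1 hu
    obtain ⟨v, hv, hvu⟩ := hle huk
    have hvu' : v = u ^ k := Subtype.ext (by simpa using hvu)
    subst hvu'
    refine Φ.mem_U_of_pow_mem (by omega) (ih u hu1) hk ?_
    simpa using hv

end NilFiltration

section Ab

variable {E : Type*}

/-- The rational abelianization of a free group. -/
noncomputable def ab (u : FreeGroup E) : E →₀ ℚ :=
  (FreeGroup.lift (fun e => Multiplicative.ofAdd (Finsupp.single e (1 : ℚ))) u).toAdd

@[simp] lemma ab_one : ab (1 : FreeGroup E) = 0 := by simp [ab]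

@[simp] lemma ab_mul (u v : FreeGroup E) : ab (u * v) = ab u + ab v := by simp [ab]

@[simp] lemma ab_inv (u : FreeGroup E) : ab u⁻¹ = -ab u := by simp [ab]

@[simp] lemma ab_of (e : E) : ab (FreeGroup.of e) = Finsupp.single e 1 := by simp [ab]

end Ab

namespace NilFiltration

variable {A : Type*} [Ring A] [Algebra ℚ A] (Φ : NilFiltration A)

lemma lift_mem_U {E : Type*} {f : E → Aˣ} {k : ℕ} (hf : ∀ e, f e ∈ Φ.U k) (u : FreeGroup E) :
    FreeGroup.lift f u ∈ Φ.U k := by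
  have : (FreeGroup.lift f).range ≤ Φ.U k := by
    rw [FreeGroup.range_lift_eq_closure, Subgroup.closure_le]
    rintro _ ⟨e, rfl⟩
    exact hf e
  exact this ⟨u, rfl⟩

lemma lift_sub_mem {E : Type*} {k : ℕ} {f f' : E → Aˣ} (hf : ∀ e, f e ∈ Φ.U 1)
    (hf' : ∀ e, f' e ∈ Φ.U 1) (η : (E →₀ ℚ) →ₗ[ℚ] Φ.I k)
    (h : ∀ e, (f' e : A) = f e * (1 + η (Finsupp.single e 1))) (u : FreeGroup E) :
    ((FreeGroup.lift f' u : Aˣ) : A) - (FreeGroup.lift f u : Aˣ) - η (ab u) ∈ Φ.I (k + 1) := by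
  induction u using FreeGroup.induction_on with
  | C1 => simp
  | of e =>
    have : ((f' e : A)) - f e - η (Finsupp.single e 1) =
        f e * η (Finsupp.single e 1) - η (Finsupp.single e 1) := by
      rw [h]; noncomm_ring
    simp only [FreeGroup.lift_apply_of, ab_of, this]
    exact Φ.mul_sub_mem' (η _).2 (hf e).1
  | inv_of e ih =>
    simp only [FreeGroup.lift_apply_of, ab_of, map_inv, ab_inv, map_neg, Submodule.coe_neg] at ih ⊢
    set x : A := ((η (Finsupp.single e 1) : Φ.I k) : A) with hx
    set d : A := (f' e : A) - f e with hd
    have e1 : (((f' e)⁻¹ : Aˣ) : A) - ((f e)⁻¹ : Aˣ) =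
        - ((((f' e)⁻¹ : Aˣ) : A) * d * ((f e)⁻¹ : Aˣ)) := by
      rw [hd, mul_sub, sub_mul]; simp
    have hd' : d ∈ Φ.I k := by
      have := add_mem (Φ.anti (Nat.le_succ k) ih) (η (Finsupp.single e 1)).2
      rwa [← hx, sub_add_cancel] at this
    have h1 := Φ.mul_sub_mem' hd' (hf' e).2
    have h2 := Φ.mul_sub_mem (Φ.mul_mem_left hd' (hf' e).2) (hf e).2
    have h3 := neg_mem (add_mem (add_mem h1 h2) ih)
    rw [e1]
    convert h3 using 1
    abel
  | mul u v hu hv =>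
    simp only [map_mul, Units.val_mul, ab_mul, map_add, Submodule.coe_add]
    set a : A := ((FreeGroup.lift f u : Aˣ) : A)
    set a' : A := ((FreeGroup.lift f' u : Aˣ) : A)
    set b : A := ((FreeGroup.lift f v : Aˣ) : A)
    set b' : A := ((FreeGroup.lift f' v : Aˣ) : A)
    set x : A := ((η (ab u) : Φ.I k) : A)
    set y : A := ((η (ab v) : Φ.I k) : A)
    have ha : a - 1 ∈ Φ.I 1 := (Φ.lift_mem_U hf u).1
    have hb' : b' - 1 ∈ Φ.I 1 := (Φ.lift_mem_U hf' v).1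
    have : a' * b' - a * b - (x + y) =
        (a' - a - x) * b' + a * (b' - b - y) + ((x * b' - x) + (a * y - y)) := by noncomm_ring
    rw [this]
    exact add_mem (add_mem (Φ.mul_mem_right hu hb') (Φ.mul_mem_left hv ha))
      (add_mem (Φ.mul_sub_mem (η _).2 hb') (Φ.mul_sub_mem' (η _).2 ha))

/-- A representation of a free group given on the letters in `J` can be extended to kill relators
which are linearly independent of `J` in the abelianization. -/
lemma exists_lift_eq_one {E X : Type*} (c : X → FreeGroup E) (J : Set E)
    (hli : LinearIndependent ℚ
      (Sum.elim (fun x => ab (c x)) (fun e : J => Finsupp.single (e : E) (1 : ℚ))))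
    (f : E → Aˣ) (hf : ∀ e, f e ∈ Φ.U 1) :
    ∃ ρ : E → Aˣ, (∀ e, ρ e ∈ Φ.U 1) ∧ (∀ e ∈ J, ρ e = f e) ∧
      ∀ x, FreeGroup.lift ρ (c x) = 1 := by
  have key : ∀ k, 1 ≤ k → ∃ ρ : E → Aˣ, (∀ e, ρ e ∈ Φ.U 1) ∧ (∀ e ∈ J, ρ e = f e) ∧
      ∀ x, FreeGroup.lift ρ (c x) ∈ Φ.U k := by
    intro k hk
    induction k, hk using Nat.le_induction with
    | base => exact ⟨f, hf, fun _ _ => rfl, fun x => Φ.lift_mem_U hf _⟩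
    | succ k hk ih =>
      obtain ⟨ρ, h1, hJ, hc⟩ := ih
      let val : X ⊕ J → Φ.I k := Sum.elim (fun x => -⟨_, (hc x).1⟩) (fun _ => 0)
      obtain ⟨η, hη⟩ := LinearMap.exists_extend ((Module.Basis.span hli).constr ℚ val)
      have hη' : ∀ i, η (Sum.elim (fun x => ab (c x))
          (fun e : J => Finsupp.single (e : E) (1 : ℚ)) i) = val i := by
        intro i
        have := LinearMap.congr_fun hη (Module.Basis.span hli i)
        rw [Module.Basis.constr_basis] at this
        rw [← this, LinearMap.comp_apply, Submodule.subtype_apply, Module.Basis.span_apply]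
      choose ε hε hεU using fun e : E => Φ.exists_unit hk (η (Finsupp.single e 1)).2
      have hρ' : ∀ e, ρ e * ε e ∈ Φ.U 1 := fun e => mul_mem (h1 e) (Φ.U_anti hk (hεU e))
      refine ⟨fun e => ρ e * ε e, hρ', fun e he => ?_, fun x => ?_⟩
      · have h0 : η (Finsupp.single e 1) = 0 := hη' (Sum.inr ⟨e, he⟩)
        have : ε e = 1 := Units.ext (by rw [hε, h0]; simp)
        simp only [this, mul_one, hJ e he]
      · refine Φ.mem_U_of_sub_mem (by omega) ?_
        have := Φ.lift_sub_mem h1 hρ' η (fun e => by rw [Units.val_mul, hε]) (c x)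
        have h0 : η (ab (c x)) = -⟨_, (hc x).1⟩ := hη' (Sum.inl x)
        rw [h0] at this
        convert this using 1
        simp
  obtain ⟨ρ, h1, hJ, hc⟩ := key Φ.N Φ.one_le
  exact ⟨ρ, h1, hJ, fun x => Φ.U_N (hc x)⟩

end NilFiltration

end RatDerived

namespace RatDerived

/-- The filtration of square matrices by superdiagonals. -/
def matrixFiltration (m : ℕ) : NilFiltration (Matrix (Fin (m + 1)) (Fin (m + 1)) ℚ) where
  I k :=
    { carrier := {M | ∀ i j : Fin (m + 1), (j : ℕ) < i + k → M i j = 0}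
      zero_mem' := fun _ _ _ => rfl
      add_mem' := fun {a b} ha hb i j h => by simp [ha i j h, hb i j h]
      smul_mem' := fun c a ha i j h => by simp [ha i j h] }
  anti := fun k l hkl M hM i j h => hM i j (by omega)
  I_mul := by
    intro k l a b ha hb i j h
    rw [Matrix.mul_apply]
    refine Finset.sum_eq_zero fun x _ => ?_
    by_cases hx : (x : ℕ) < i + k
    · rw [ha i x hx, zero_mul]
    · rw [hb x j (by omega), mul_zero]
  N := m + 1
  one_le := by omega
  eq_bot := by
    rw [eq_bot_iff]
    intro M hM
    rw [Submodule.mem_bot]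
    ext i j
    exact hM i j (by omega)

/-- Every element of a free group is a product of syllables. -/
lemma exists_syllables {E : Type*} (g : FreeGroup E) :
    ∃ l : List (E × ℤ), l.IsChain (fun p q => p.1 ≠ q.1) ∧ (∀ p ∈ l, p.2 ≠ 0) ∧
      g = (l.map fun p => FreeGroup.of p.1 ^ p.2).prod := by
  classical
  have step : ∀ (e : E) (b : ℤ), b ≠ 0 → ∀ l : List (E × ℤ),
      l.IsChain (fun p q => p.1 ≠ q.1) → (∀ p ∈ l, p.2 ≠ 0) →
      ∃ l' : List (E × ℤ), l'.IsChain (fun p q => p.1 ≠ q.1) ∧ (∀ p ∈ l', p.2 ≠ 0) ∧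
        FreeGroup.of e ^ b * (l.map fun p => FreeGroup.of p.1 ^ p.2).prod =
          (l'.map fun p => FreeGroup.of p.1 ^ p.2).prod := by
    intro e b hb l hl hl0
    rcases l with _ | ⟨⟨y, a⟩, l⟩
    · exact ⟨[(e, b)], by simp, by simpa using hb, by simp⟩
    · by_cases hy : e = y
      · subst hy
        by_cases hab : b + a = 0
        · refine ⟨l, hl.tail, fun p hp => hl0 p (by simp [hp]), ?_⟩
          simp [← mul_assoc, ← zpow_add, hab]
        · refine ⟨(e, b + a) :: l, ?_, ?_, ?_⟩
          · rcases l with _ | ⟨q, l⟩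
            · simp
            · simpa using hl
          · intro p hp
            rcases List.mem_cons.1 hp with rfl | hp
            · exact hab
            · exact hl0 p (by simp [hp])
          · simp [← mul_assoc, ← zpow_add]
      · refine ⟨(e, b) :: (y, a) :: l, ?_, ?_, ?_⟩
        · exact List.isChain_cons_cons.2 ⟨hy, hl⟩
        · intro p hp
          rcases List.mem_cons.1 hp with rfl | hp
          · exact hb
          · exact hl0 p hp
        · simp
  rw [← FreeGroup.mk_toWord (x := g)]
  induction g.toWord with
  | nil => exact ⟨[], by simp, by simp, rfl⟩
  | cons p L ih =>
    obtain ⟨l, h1, h2, h3⟩ := ih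
    obtain ⟨e, b⟩ := p
    have hmk : FreeGroup.mk ((e, b) :: L) =
        FreeGroup.of e ^ (if b then 1 else -1 : ℤ) * FreeGroup.mk L := by
      cases b
      · simp [FreeGroup.of, FreeGroup.inv_mk, FreeGroup.mul_mk, FreeGroup.invRev]
      · simp [FreeGroup.of, FreeGroup.mul_mk]
    obtain ⟨l', h1', h2', hval⟩ := step e (if b then 1 else -1) (by split_ifs <;> simp) l h1 h2
    exact ⟨l', h1', h2', by rw [hmk, h3, hval]⟩

/-- Free groups are detected by unipotent matrices. -/
lemma exists_lift_ne_one {E : Type*} {g : FreeGroup E} (hg : g ≠ 1) :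
    ∃ (m : ℕ) (f : E → (Matrix (Fin (m + 1)) (Fin (m + 1)) ℚ)ˣ),
      (∀ e, f e ∈ (matrixFiltration m).U 1) ∧ FreeGroup.lift f g ≠ 1 := by
  classical
  obtain ⟨l, hl, hl0, rfl⟩ := exists_syllables g
  have hlne : l ≠ [] := by rintro rfl; simp at hg
  let m := l.length
  let y : ℕ → Option E := fun i => (l[i]?).map Prod.fst
  have hy : ∀ i e, y i = some e → y (i + 1) = some e → False := by
    intro i e h1 h2
    simp only [y, Option.map_eq_some_iff] at h1 h2
    obtain ⟨p, hp, rfl⟩ := h1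
    obtain ⟨q, hq, hpq⟩ := h2
    obtain ⟨hi, rfl⟩ := List.getElem?_eq_some_iff.1 hp
    obtain ⟨hi', rfl⟩ := List.getElem?_eq_some_iff.1 hq
    exact List.isChain_iff_getElem.1 hl i hi' hpq.symm
  let Nm : E → Matrix (Fin (m + 1)) (Fin (m + 1)) ℚ := fun e =>
    Matrix.of fun i j => if (j : ℕ) = i + 1 ∧ y i = some e then 1 else 0
  have hNI : ∀ e, Nm e ∈ (matrixFiltration m).I 1 := by
    intro e i j h
    simp only [Nm, Matrix.of_apply]
    rw [if_neg (by omega)]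
  have hN2 : ∀ e, Nm e * Nm e = 0 := by
    intro e
    ext i j
    rw [Matrix.mul_apply, Matrix.zero_apply]
    refine Finset.sum_eq_zero fun x _ => ?_
    simp only [Nm, Matrix.of_apply]
    split_ifs with h1 h2 <;> try simp
    exact hy i e h1.2 (by rw [← h1.1]; exact h2.2)
  choose f hf hfU using fun e => (matrixFiltration m).exists_unit le_rfl (hNI e)
  refine ⟨m, f, hfU, fun h1 => ?_⟩
  have hpow : ∀ e (a : ℤ), ((f e ^ a : (Matrix (Fin (m + 1)) (Fin (m + 1)) ℚ)ˣ) :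
      Matrix (Fin (m + 1)) (Fin (m + 1)) ℚ) = 1 + (a : ℚ) • Nm e := by
    intro e a
    have hinv : (((f e)⁻¹ : (Matrix (Fin (m + 1)) (Fin (m + 1)) ℚ)ˣ) :
        Matrix (Fin (m + 1)) (Fin (m + 1)) ℚ) = 1 - Nm e := by
      rw [Units.inv_eq_of_mul_eq_one_right]
      rw [hf, add_mul, mul_sub, mul_sub, hN2]; simp
    induction a using Int.induction_on with
    | zero => simp
    | succ a ih =>
      rw [zpow_add_one, Units.val_mul, ih, hf, add_mul, mul_add, mul_add, smul_mul_assoc,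
        smul_mul_assoc, hN2]
      push_cast
      rw [add_smul]
      simp [add_assoc, add_comm]
    | pred a ih =>
      rw [zpow_sub_one, Units.val_mul, ih, hinv, add_mul, mul_sub, mul_sub, smul_mul_assoc,
        smul_mul_assoc, hN2]
      push_cast
      rw [sub_smul]
      simp only [one_mul, mul_one, smul_zero, sub_zero, one_smul]
      abel
  let P : ℕ → Matrix (Fin (m + 1)) (Fin (m + 1)) ℚ := fun k =>
    (FreeGroup.lift f ((l.drop k).map fun p => FreeGroup.of p.1 ^ p.2).prod : _ˣ)
  have key : ∀ d k, k + d = m → (∀ j : Fin (m + 1), (j : ℕ) < k → P k j (Fin.last m) = 0) ∧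
      ∀ j : Fin (m + 1), (j : ℕ) = k → P k j (Fin.last m) ≠ 0 := by
    intro d
    induction d with
    | zero =>
      intro k hk
      have : P k = 1 := by
        have : l.drop k = [] := List.drop_eq_nil_of_le (by omega)
        simp only [P, this, List.map_nil, List.prod_nil, map_one, Units.val_one]
      rw [this]
      refine ⟨fun j hj => Matrix.one_apply_ne ?_, fun j hj => ?_⟩
      · rintro rfl; simp at hj; omega
      · have : j = Fin.last m := Fin.ext (by simp; omega)
        rw [this]; simp
    | succ d ih =>
      intro k hk
      obtain ⟨ih1, ih2⟩ := ih (k + 1) (by omega)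
      have hkl : k < l.length := by omega
      have hPk : P k = (1 + ((l[k].2 : ℤ) : ℚ) • Nm l[k].1) * P (k + 1) := by
        simp only [P]
        rw [List.drop_eq_getElem_cons hkl, List.map_cons, List.prod_cons, map_mul, Units.val_mul,
          map_zpow, FreeGroup.lift_apply_of, hpow]
      have hent : ∀ j : Fin (m + 1), ∀ hj : (j : ℕ) < m, P k j (Fin.last m) =
          P (k + 1) j (Fin.last m) + ((l[k].2 : ℤ) : ℚ) * ((if y j = some l[k].1 then 1 else 0) *
            P (k + 1) ⟨j + 1, by omega⟩ (Fin.last m)) := by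
        intro j hj
        rw [hPk, add_mul, one_mul, Matrix.add_apply, smul_mul_assoc, Matrix.smul_apply,
          Matrix.mul_apply, smul_eq_mul]
        congr 2
        rw [Finset.sum_eq_single (⟨j + 1, by omega⟩ : Fin (m + 1))]
        · simp [Nm]
        · intro x _ hx
          have : (x : ℕ) ≠ j + 1 := fun h => hx (Fin.ext h)
          simp [Nm, this]
        · simp
      refine ⟨fun j hj => ?_, fun j hj => ?_⟩
      · rw [hent j (by omega), ih1 j (by omega), ih1 _ (by simpa using hj)]; simp
      · have hyk : y j = some l[k].1 := by simp [y, hj, hkl]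
        rw [hent j (by omega), ih1 j (by omega), if_pos hyk, zero_add, one_mul]
        refine mul_ne_zero ?_ (ih2 _ (by simpa using hj))
        exact_mod_cast hl0 _ (List.getElem_mem hkl)
  have h0 := (key m 0 (by omega)).2 0 rfl
  have hP0 : P 0 = 1 := by simp only [P, List.drop_zero, h1]; rfl
  rw [hP0] at h0
  refine h0 (Matrix.one_apply_ne fun h => hlne ?_)
  have := congrArg Fin.val h
  simp only [Fin.val_last, Fin.val_zero] at this
  exact List.length_eq_zero_iff.1 this.symm

end RatDerived

namespace RatDerived

/-- A form of local indicability: every nontrivial finite set `T` is detected by a map to `ℤ` which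
is affine along `T`. -/
def LocInd (Q : Type*) [Group Q] : Prop :=
  ∀ T : Finset Q, (∃ t ∈ T, t ≠ 1) → ∃ g f : Q → ℤ,
    (∀ q, ∀ t ∈ T, g (q * t) = g q + f t) ∧ ∃ t ∈ T, f t ≠ 0

lemma exists_int_hom {M : Type*} [AddCommGroup M] [Module.Finite ℤ M] (x : M)
    (hx : ∀ k : ℕ, 1 ≤ k → k • x ≠ 0) : ∃ f : M →ₗ[ℤ] ℤ, f x ≠ 0 := by
  let T := Submodule.torsion ℤ M
  have : Module.Free ℤ (M ⧸ T) := Module.free_of_finite_type_torsion_free'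
  let b := Module.Free.chooseBasis ℤ (M ⧸ T)
  have hx0 : T.mkQ x ≠ 0 := by
    intro h
    rw [Submodule.mkQ_apply, Submodule.Quotient.mk_eq_zero, Submodule.mem_torsion_iff] at h
    obtain ⟨⟨a, ha⟩, hax⟩ := h
    have ha0 : a ≠ 0 := nonZeroDivisors.ne_zero ha
    change a • x = 0 at hax
    refine hx a.natAbs (Int.natAbs_pos.2 ha0) ?_
    rcases Int.natAbs_eq a with h | h
    · rwa [h, natCast_zsmul] at hax
    · rwa [h, neg_smul, natCast_zsmul, neg_eq_zero] at hax
  have : ∃ i, b.coord i (T.mkQ x) ≠ 0 := by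
    by_contra! h
    exact hx0 (b.forall_coord_eq_zero_iff.1 h)
  obtain ⟨i, hi⟩ := this
  exact ⟨(b.coord i).comp T.mkQ, hi⟩

lemma exists_hom_of_pow_notMem {P : Type*} [Group P] [Group.FG P] (u : P)
    (hu : ∀ k : ℕ, 1 ≤ k → u ^ k ∉ ⁅(⊤ : Subgroup P), (⊤ : Subgroup P)⁆) :
    ∃ f : P →* Multiplicative ℤ, f u ≠ 1 := by
  have : Group.FG (Abelianization P) := by
    unfold Abelianization; infer_instance
  have : Module.Finite ℤ (Additive (Abelianization P)) := by
    rw [Module.Finite.iff_addGroup_fg]; infer_instance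
  obtain ⟨f, hf⟩ := exists_int_hom (Additive.ofMul (Abelianization.of u)) (by
    intro k hk h
    refine hu k hk ?_
    rw [← ofMul_pow, ← map_pow, ofMul_eq_zero] at h
    exact (QuotientGroup.eq_one_iff _).1 h)
  refine ⟨(AddMonoidHom.toMultiplicativeRight f.toAddMonoidHom).comp Abelianization.of, ?_⟩
  intro h
  exact hf (Multiplicative.ofAdd.injective h)

lemma locInd_of_pre {G : Type*} [Group G] (K : Subgroup G) [K.Normal] (n : ℕ) :
    LocInd (G ⧸ pre K n) := by
  classical
  intro T hT
  let Q := G ⧸ pre K n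
  let P : Subgroup Q := Subgroup.closure (T : Set Q)
  let D : ℕ → Subgroup Q := fun i => (pre K i).map (QuotientGroup.mk' (pre K n))
  have hD0 : D 0 = ⊤ := by
    simp only [D, pre_zero]
    exact Subgroup.map_top_of_surjective _ (QuotientGroup.mk'_surjective _)
  have hDn : D n = ⊥ := by
    simp only [D]
    exact QuotientGroup.map_mk'_self _
  have hPn : ¬ P ≤ D n := by
    obtain ⟨t, ht, ht1⟩ := hT
    intro h
    have := h (Subgroup.subset_closure ht)
    rw [hDn, Subgroup.mem_bot] at this
    exact ht1 this
  have hex : ∃ i, i < n ∧ P ≤ D i ∧ ¬ P ≤ D (i + 1) := by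
    by_contra! h
    have : ∀ i, i ≤ n → P ≤ D i := by
      intro i
      induction i with
      | zero => intro _; rw [hD0]; exact le_top
      | succ i ih => intro hi; exact h i (by omega) (ih (by omega))
    exact hPn (this n le_rfl)
  obtain ⟨i, hi, hPi, hPi'⟩ := hex
  obtain ⟨u, huP, hu⟩ := SetLike.not_le_iff_exists.1 hPi'
  have hpow : ∀ k : ℕ, 1 ≤ k → u ^ k ∉ ⁅D i, D i⁆ := by
    intro k hk h
    apply hu
    obtain ⟨v, hv, rfl⟩ := hPi huP
    refine ⟨v, ?_, rfl⟩
    simp only [D, ← Subgroup.map_commutator] at h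
    obtain ⟨c, hc, hcv⟩ := h
    refine mem_pre_succ_of_pow hv hk ?_
    rw [← map_pow, QuotientGroup.mk'_apply, QuotientGroup.mk'_apply, QuotientGroup.eq] at hcv
    have h1 : c⁻¹ * v ^ k ∈ pre K (i + 1) := pre_antitone (by omega) hcv
    have h2 : c ∈ pre K (i + 1) := commutator_sup_le i (Subgroup.mem_sup_left hc)
    simpa using mul_mem h2 h1
  have : Group.FG P := (Group.fg_iff_subgroup_fg P).2 ⟨T, rfl⟩
  obtain ⟨f₀, hf₀⟩ := exists_hom_of_pow_notMem (⟨u, huP⟩ : P) (by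
    intro k hk h
    refine hpow k hk ?_
    have h2 := Subgroup.mem_map_of_mem P.subtype h
    rw [Subgroup.map_commutator] at h2
    have h3 : (⊤ : Subgroup P).map P.subtype ≤ D i := by
      rw [← MonoidHom.range_eq_map, Subgroup.range_subtype]; exact hPi
    exact Subgroup.commutator_mono h3 h3 h2)
  have hTP : ∀ t ∈ T, t ∈ P := fun t ht => Subgroup.subset_closure ht
  have hout : ∀ q : Q, (Quotient.out (QuotientGroup.mk q : Q ⧸ P))⁻¹ * q ∈ P := by
    intro q
    rw [← QuotientGroup.eq]
    exact Quotient.out_eq _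
  refine ⟨fun q => (f₀ ⟨_, hout q⟩).toAdd,
    fun t => if h : t ∈ P then (f₀ ⟨t, h⟩).toAdd else 0, ?_, ?_⟩
  · intro q t ht
    have hmk : (QuotientGroup.mk (q * t) : Q ⧸ P) = QuotientGroup.mk q :=
      (QuotientGroup.eq.2 (by simpa using hTP t ht)).symm
    simp only [dif_pos (hTP t ht)]
    rw [← toAdd_mul, ← map_mul]
    congr 2
    apply Subtype.ext
    simp [hmk, mul_assoc]
  · by_contra! h
    apply hf₀
    have : f₀ = 1 := by
      refine MonoidHom.eq_of_eqOn_top fun x _ => ?_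
      obtain ⟨x, hx⟩ := x
      induction hx using Subgroup.closure_induction with
      | mem x hx =>
        have := h x hx
        rw [dif_pos (hTP x hx)] at this
        exact Multiplicative.toAdd.injective this
      | one => exact map_one f₀
      | mul x y hx hy ihx ihy =>
        have := map_mul f₀ ⟨x, hx⟩ ⟨y, hy⟩
        rw [ihx trivial, ihy trivial] at this
        exact this
      | inv x hx ih =>
        have := map_inv f₀ ⟨x, hx⟩
        rw [ih trivial] at this
        exact this
    rw [this]; rfl

namespace LocInd

variable {Q : Type*} [Group Q]

lemma exists_left (hQ : LocInd Q) (T : Finset Q) (hT : ∃ t ∈ T, t ≠ 1) : ∃ g f : Q → ℤ,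
    (∀ t ∈ T, ∀ q, g (t * q) = f t + g q) ∧ ∃ t ∈ T, f t ≠ 0 := by
  classical
  obtain ⟨t, ht, ht1⟩ := hT
  obtain ⟨g, f, h, y, hy, hfy⟩ := hQ (T.image (·⁻¹)) ⟨t⁻¹, Finset.mem_image_of_mem _ ht, by simpa⟩
  obtain ⟨y, hyT, rfl⟩ := Finset.mem_image.1 hy
  refine ⟨fun q => g q⁻¹, fun t => f t⁻¹, fun t ht q => ?_, y, hyT, hfy⟩
  simp only [mul_inv_rev]
  rw [h _ _ (Finset.mem_image_of_mem _ ht), add_comm]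

lemma exists_right (hQ : LocInd Q) {C : Finset Q} (hC : C.Nontrivial) : ∃ g h f : Q → ℤ,
    (∀ q, ∀ y ∈ C, g (q * y) = h q + f y) ∧ ∃ y ∈ C, ∃ z ∈ C, f y < f z := by
  classical
  obtain ⟨c, hc, d, hd, hcd⟩ := hC
  obtain ⟨g, f, h, t, ht, hft⟩ := hQ (C.image (c⁻¹ * ·))
    ⟨c⁻¹ * d, Finset.mem_image_of_mem _ hd, by
      intro h; exact hcd (inv_mul_eq_one.1 h)⟩
  obtain ⟨y, hy, rfl⟩ := Finset.mem_image.1 ht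
  have hmain : ∀ q, ∀ y ∈ C, g (q * y) = g (q * c) + f (c⁻¹ * y) := by
    intro q y hy
    rw [← h _ _ (Finset.mem_image_of_mem _ hy)]
    congr 1; group
  have h1 : f (c⁻¹ * c) = 0 := by
    have := hmain 1 c hc
    omega
  refine ⟨g, fun q => g (q * c), fun y => f (c⁻¹ * y), hmain, ?_⟩
  rcases lt_or_gt_of_ne hft with h2 | h2
  · exact ⟨y, hy, c, hc, by simp only [h1]; exact h2⟩
  · exact ⟨c, hc, y, hy, by simp only [h1]; exact h2⟩

lemma uniqueProds (hQ : LocInd Q) : UniqueProds Q := by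
  classical
  have key : ∀ n, ∀ A B : Finset Q, B.card = n → A.Nonempty → B.Nonempty →
      ∃ a ∈ A, ∃ b ∈ B, UniqueMul A B a b := by
    intro n
    induction n using Nat.strong_induction_on with
    | _ n ih =>
      intro A B hn hA hB
      rcases B.eq_singleton_or_nontrivial hB.choose_spec with h | h
      · obtain ⟨a, ha⟩ := hA
        refine ⟨a, ha, _, hB.choose_spec, ?_⟩
        intro a' b' ha' hb' hab
        have hb : b' = hB.choose := by rw [h] at hb'; simpa using hb'
        subst hb
        exact ⟨mul_right_cancel hab, rfl⟩
      · obtain ⟨g, h, f, hg, y, hy, z, hz, hyz⟩ := hQ.exists_right h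
        obtain ⟨a₀, ha₀, hmaxA⟩ := A.exists_max_image h hA
        obtain ⟨b₀, hb₀, hmaxB⟩ := B.exists_max_image f hB
        have hlt : (B.filter fun b => f b = f b₀).card < n := by
          rw [← hn]
          refine Finset.card_lt_card (Finset.filter_ssubset.2 ⟨y, hy, ?_⟩)
          have := hmaxB z hz
          omega
        obtain ⟨a, ha, b, hb, hab⟩ := ih _ hlt (A.filter fun a => h a = h a₀)
          (B.filter fun b => f b = f b₀) rfl ⟨a₀, by simp [ha₀]⟩ ⟨b₀, by simp [hb₀]⟩
        rw [Finset.mem_filter] at ha hb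
        refine ⟨a, ha.1, b, hb.1, fun a' b' ha' hb' he => ?_⟩
        have h1 := hg a b hb.1
        have h2 := hg a' b' hb'
        rw [he] at h2
        have h3 := hmaxA a' ha'
        have h4 := hmaxB b' hb'
        exact hab (by rw [Finset.mem_filter]; exact ⟨ha', by omega⟩)
          (by rw [Finset.mem_filter]; exact ⟨hb', by omega⟩) he
  exact ⟨fun hA hB => key _ _ _ rfl hA hB⟩

end LocInd

section Support

variable {Q : Type*} [Group Q] [UniqueProds Q]

lemma exists_mem_support_mul {α γ : MonoidAlgebra ℚ Q} (hα : α ≠ 0) (hγ : γ ≠ 0) {g h f : Q → ℤ}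
    (H : ∀ x ∈ α.coeff.support, ∀ y ∈ γ.coeff.support, g (x * y) = h x + f y) :
    ∃ z ∈ (α * γ).coeff.support, ∀ x ∈ α.coeff.support, ∀ y ∈ γ.coeff.support,
      h x + f y ≤ g z := by
  classical
  have hα' : α.coeff.support.Nonempty := by simpa [Finsupp.support_nonempty_iff] using hα
  have hγ' : γ.coeff.support.Nonempty := by simpa [Finsupp.support_nonempty_iff] using hγ
  obtain ⟨a₀, ha₀, hmaxA⟩ := α.coeff.support.exists_max_image h hα'
  obtain ⟨b₀, hb₀, hmaxB⟩ := γ.coeff.support.exists_max_image f hγ'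
  obtain ⟨a, ha, b, hb, hab⟩ := UniqueProds.uniqueMul_of_nonempty
    (A := α.coeff.support.filter fun a => h a = h a₀)
    (B := γ.coeff.support.filter fun b => f b = f b₀) ⟨a₀, by simp [-Finsupp.mem_support_iff, ha₀]⟩
    ⟨b₀, by simp [-Finsupp.mem_support_iff, hb₀]⟩
  rw [Finset.mem_filter] at ha hb
  have hu : UniqueMul α.coeff.support γ.coeff.support a b := by
    intro a' b' ha' hb' he
    have h1 := H a ha.1 b hb.1
    have h2 := H a' ha' b' hb'
    rw [he] at h2
    have h3 := hmaxA a' ha'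
    have h4 := hmaxB b' hb'
    exact hab (by rw [Finset.mem_filter]; exact ⟨ha', by omega⟩)
      (by rw [Finset.mem_filter]; exact ⟨hb', by omega⟩) he
  refine ⟨a * b, ?_, fun x hx y hy => ?_⟩
  · rw [Finsupp.mem_support_iff, MonoidAlgebra.coeff_mul_mul_of_uniqueMul hu]
    exact mul_ne_zero (Finsupp.mem_support_iff.1 ha.1) (Finsupp.mem_support_iff.1 hb.1)
  · rw [H a ha.1 b hb.1]
    have h3 := hmaxA x hx
    have h4 := hmaxB y hy
    omega

lemma exists_mem_support_mul_le {α γ : MonoidAlgebra ℚ Q} (hα : α ≠ 0) (hγ : γ ≠ 0)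
    {g h f : Q → ℤ}
    (H : ∀ x ∈ α.coeff.support, ∀ y ∈ γ.coeff.support, g (x * y) = h x + f y) :
    ∃ z ∈ (α * γ).coeff.support, ∀ x ∈ α.coeff.support, ∀ y ∈ γ.coeff.support,
      g z ≤ h x + f y := by
  obtain ⟨z, hz, hz'⟩ := exists_mem_support_mul hα hγ (g := -g) (h := -h) (f := -f)
    (fun x hx y hy => by simp only [Pi.neg_apply]; rw [H x hx y hy]; ring)
  refine ⟨z, hz, fun x hx y hy => ?_⟩
  have := hz' x hx y hy
  simp only [Pi.neg_apply] at this
  omega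

/-- An element of the group algebra not enlarging the support of a nonzero element is a scalar. -/
lemma LocInd.support_subset_one (hQ : LocInd Q) {α β : MonoidAlgebra ℚ Q} (hβ : β ≠ 0)
    (h : (α * β).coeff.support ⊆ β.coeff.support) : α.coeff.support ⊆ {1} := by
  by_contra hne
  have hex : ∃ t ∈ α.coeff.support, t ≠ 1 := by
    by_contra! hh
    exact hne fun t ht => by simpa using hh t ht
  obtain ⟨g, f, hg, t, ht, hft⟩ := hQ.exists_left _ hex
  have hα : α ≠ 0 := by rintro rfl; simp at ht
  obtain ⟨z, hz, hz1⟩ := exists_mem_support_mul hα hβ (fun x hx y _ => hg x hx y)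
  obtain ⟨z', hz', hz1'⟩ := exists_mem_support_mul_le hα hβ (fun x hx y _ => hg x hx y)
  have h1 := hz1 t ht z (h hz)
  have h2 := hz1' t ht z' (h hz')
  omega

end Support

end RatDerived

namespace RatDerived

section Convex

variable {Q : Type*}

open Classical in
/-- Restriction of an element of the group algebra to a set of group elements. -/
noncomputable def restrict (α : MonoidAlgebra ℚ Q) (p : Q → Prop) : MonoidAlgebra ℚ Q :=
  .ofCoeff (α.coeff.filter p)

lemma mem_support_restrict {α : MonoidAlgebra ℚ Q} {p : Q → Prop} {x : Q} :
    x ∈ (restrict α p).coeff.support ↔ x ∈ α.coeff.support ∧ p x := by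
  classical
  simp [restrict, and_comm]

lemma restrict_add_restrict (α : MonoidAlgebra ℚ Q) (p : Q → Prop) :
    restrict α p + restrict α (fun x => ¬ p x) = α := by
  classical
  ext x
  rw [MonoidAlgebra.coeff_add, Finsupp.add_apply]
  by_cases h : p x <;> simp [restrict, h]

variable [Group Q]

lemma exists_eq_mul_of_coeff_ne_zero {α β : MonoidAlgebra ℚ Q} {z : Q}
    (hz : (α * β).coeff z ≠ 0) :
    ∃ x ∈ α.coeff.support, ∃ y ∈ β.coeff.support, x * y = z := by
  classical
  have := MonoidAlgebra.support_coeff_mul_subset α β (Finsupp.mem_support_iff.2 hz)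
  exact Finset.mem_mul.1 this

/-- `E` is convex for right multiplication by `γ`. -/
def IsConvexFor (γ : MonoidAlgebra ℚ Q) (E : Finset Q) : Prop :=
  ∀ α : MonoidAlgebra ℚ Q, (α * γ).coeff.support ⊆ E →
    ∀ x ∈ α.coeff.support, ∀ y ∈ γ.coeff.support, x * y ∈ E

lemma exists_convex_step [UniqueProds Q] {γ γt : MonoidAlgebra ℚ Q} (hγ : γ ≠ 0)
    {g h f : Q → ℤ} {d : ℤ}
    (hg : ∀ x, ∀ y ∈ γ.coeff.support, g (x * y) = h x + f y)
    (hd : ∀ y ∈ γ.coeff.support, f y ≤ d) (hγt : γt = restrict γ (fun y => f y = d))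
    {c : Q} (hc : c ∈ γt.coeff.support)
    (ih : ∀ E₀ : Finset Q, ∃ E, E₀ ⊆ E ∧ IsConvexFor γt E) (l : ℤ) (m : ℕ) :
    ∀ E₀ : Finset Q, (∀ z ∈ E₀, l ≤ g z ∧ g z < l + m) →
      ∃ E, E₀ ⊆ E ∧ (∀ z ∈ E, l ≤ g z ∧ g z < l + m) ∧ IsConvexFor γ E := by
  classical
  have hmemt : ∀ y, y ∈ γt.coeff.support ↔ y ∈ γ.coeff.support ∧ f y = d := by
    intro y; rw [hγt]; exact mem_support_restrict
  induction m with
  | zero =>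
    intro E₀ hE₀
    have hE : ∀ z, z ∉ E₀ := fun z hz => by have := hE₀ z hz; omega
    refine ⟨E₀, subset_rfl, hE₀, fun α hα x hx y hy => ?_⟩
    exfalso
    have hα0 : α ≠ 0 := by rintro rfl; simp at hx
    obtain ⟨z, hz, -⟩ := exists_mem_support_mul hα0 hγ (fun x _ y hy => hg x y hy)
    exact hE z (hα hz)
  | succ m ihm =>
    intro E₀ hE₀
    set L : ℤ := l + m with hL
    obtain ⟨E₁, h01, hconv₁⟩ := ih (E₀.filter fun z => g z = L)
    set E₁' := E₁.filter fun z => g z = L with hE₁'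
    set U := (E₁'.image (· * c⁻¹)).filter fun x => h x = L - d ∧
      (∀ y ∈ γ.coeff.support, l ≤ h x + f y) ∧ ∀ y ∈ γt.coeff.support, x * y ∈ E₁' with hU
    set V := Finset.image₂ (· * ·) U γ.coeff.support with hV
    have hVg : ∀ z ∈ V, l ≤ g z ∧ g z ≤ L ∧ (g z = L → z ∈ E₁') := by
      intro z hz
      obtain ⟨x, hx, y, hy, rfl⟩ := Finset.mem_image₂.1 hz
      obtain ⟨-, hx1, hx2, hx3⟩ := Finset.mem_filter.1 hx
      have h1 := hg x y hy
      have h2 := hx2 y hy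
      have h3 := hd y hy
      refine ⟨by omega, by omega, fun h4 => hx3 y ((hmemt y).2 ⟨hy, by omega⟩)⟩
    obtain ⟨E', hE', hE'g, hconv'⟩ := ihm ((E₀ ∪ V).filter fun z => g z < L) (by
      intro z hz
      obtain ⟨hz, hzL⟩ := Finset.mem_filter.1 hz
      refine ⟨?_, hzL⟩
      rcases Finset.mem_union.1 hz with hz | hz
      · exact (hE₀ z hz).1
      · exact (hVg z hz).1)
    have hVE : V ⊆ E' ∪ E₁' := by
      intro z hz
      obtain ⟨h1, h2, h3⟩ := hVg z hz
      rcases h2.lt_or_eq with h2 | h2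
      · exact Finset.mem_union_left _ (hE' (by simp [hz, h2]))
      · exact Finset.mem_union_right _ (h3 h2)
    refine ⟨E' ∪ E₁', ?_, ?_, ?_⟩
    · intro z hz
      have h1 := (hE₀ z hz).2
      push_cast at h1
      rcases (show g z ≤ L by omega).lt_or_eq with h2 | h2
      · exact Finset.mem_union_left _ (hE' (by simp [hz, h2]))
      · exact Finset.mem_union_right _ (Finset.mem_filter.2 ⟨h01 (by simp [hz, h2]), h2⟩)
    · intro z hz
      push_cast
      rcases Finset.mem_union.1 hz with hz | hz
      · have := hE'g z hz
        omega
      · have := (Finset.mem_filter.1 hz).2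
        omega
    · intro α hα
      have hα0 : ∀ x ∈ α.coeff.support, α ≠ 0 := by rintro x hx rfl; simp at hx
      have hupper : ∀ x ∈ α.coeff.support, ∀ y ∈ γ.coeff.support, h x + f y ≤ L := by
        intro x hx y hy
        obtain ⟨z, hz, hz1⟩ := exists_mem_support_mul (hα0 x hx) hγ (fun x _ y hy => hg x y hy)
        refine (hz1 x hx y hy).trans ?_
        rcases Finset.mem_union.1 (hα hz) with hz | hz
        · exact (hE'g z hz).2.le
        · exact (Finset.mem_filter.1 hz).2.le
      have hlower : ∀ x ∈ α.coeff.support, ∀ y ∈ γ.coeff.support, l ≤ h x + f y := by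
        intro x hx y hy
        obtain ⟨z, hz, hz1⟩ := exists_mem_support_mul_le (hα0 x hx) hγ
          (fun x _ y hy => hg x y hy)
        refine le_trans ?_ (hz1 x hx y hy)
        rcases Finset.mem_union.1 (hα hz) with hz | hz
        · exact (hE'g z hz).1
        · have := (Finset.mem_filter.1 hz).2
          omega
      set αL := restrict α (fun x => h x = L - d) with hαL
      set αR := restrict α (fun x => ¬ h x = L - d) with hαR
      have hαLR : αL + αR = α := restrict_add_restrict _ _
      set γr := restrict γ (fun y => ¬ f y = d) with hγr
      have hγtr : γt + γr = γ := by rw [hγt]; exact restrict_add_restrict _ _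
      have hcγ := (hmemt c).1 hc
      have hRlt : ∀ z, (αR * γ).coeff z ≠ 0 → g z < L := by
        intro z hz
        obtain ⟨x, hx, y, hy, rfl⟩ := exists_eq_mul_of_coeff_ne_zero hz
        obtain ⟨hx1, hx2⟩ := mem_support_restrict.1 hx
        have h1 := hg x y hy
        have h2 := hupper x hx1 c hcγ.1
        have h3 := hd y hy
        have h4 := hcγ.2
        omega
      have hrlt : ∀ z, (αL * γr).coeff z ≠ 0 → g z < L := by
        intro z hz
        obtain ⟨x, hx, y, hy, rfl⟩ := exists_eq_mul_of_coeff_ne_zero hz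
        obtain ⟨hx1, hx2⟩ := mem_support_restrict.1 hx
        obtain ⟨hy1, hy2⟩ := mem_support_restrict.1 hy
        have h1 := hg x y hy1
        have h3 := hd y hy1
        omega
      have hLt : (αL * γt).coeff.support ⊆ E₁ := by
        intro z hz
        rw [Finsupp.mem_support_iff] at hz
        obtain ⟨x, hx, y, hy, rfl⟩ := exists_eq_mul_of_coeff_ne_zero hz
        obtain ⟨hx1, hx2⟩ := mem_support_restrict.1 hx
        obtain ⟨hy1, hy2⟩ := (hmemt y).1 hy
        have h1 : g (x * y) = L := by rw [hg x y hy1]; omega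
        have h2 : (αR * γ).coeff (x * y) = 0 := by
          by_contra h; have := hRlt _ h; omega
        have h3 : (αL * γr).coeff (x * y) = 0 := by
          by_contra h; have := hrlt _ h; omega
        have h4 : α * γ = αL * γt + αL * γr + αR * γ := by
          rw [← mul_add, hγtr, ← add_mul, hαLR]
        have h5 : (α * γ).coeff (x * y) = (αL * γt).coeff (x * y) := by
          rw [h4, MonoidAlgebra.coeff_add, MonoidAlgebra.coeff_add, Finsupp.add_apply,
            Finsupp.add_apply, h2, h3, add_zero, add_zero]
        have h6 := hα (Finsupp.mem_support_iff.2 (by rwa [h5]))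
        rcases Finset.mem_union.1 h6 with h6 | h6
        · have := hE'g _ h6
          omega
        · exact (Finset.mem_filter.1 h6).1
      have hLU : ∀ x ∈ αL.coeff.support, x ∈ U := by
        intro x hx
        obtain ⟨hx1, hx2⟩ := mem_support_restrict.1 hx
        have h1 : ∀ y ∈ γt.coeff.support, x * y ∈ E₁' := by
          intro y hy
          obtain ⟨hy1, hy2⟩ := (hmemt y).1 hy
          exact Finset.mem_filter.2 ⟨hconv₁ αL hLt x hx y hy, by rw [hg x y hy1]; omega⟩
        exact Finset.mem_filter.2 ⟨Finset.mem_image.2 ⟨x * c, h1 c hc, by simp⟩, hx2,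
          hlower x hx1, h1⟩
      have hRsupp : (αR * γ).coeff.support ⊆ E' := by
        intro z hz
        rw [Finsupp.mem_support_iff] at hz
        have hlt := hRlt z hz
        have hmem : z ∈ E' ∪ E₁' := by
          by_cases hz' : (α * γ).coeff z = 0
          · have : (αL * γ).coeff z ≠ 0 := by
              rw [← hαLR, add_mul, MonoidAlgebra.coeff_add, Finsupp.add_apply] at hz'
              intro h0
              rw [h0, zero_add] at hz'
              exact hz hz'
            obtain ⟨x, hx, y, hy, rfl⟩ := exists_eq_mul_of_coeff_ne_zero this
            exact hVE (Finset.mem_image₂_of_mem (hLU x hx) hy)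
          · exact hα (Finsupp.mem_support_iff.2 hz')
        rcases Finset.mem_union.1 hmem with h | h
        · exact h
        · have := (Finset.mem_filter.1 h).2
          omega
      intro x hx y hy
      by_cases hxL : h x = L - d
      · exact hVE (Finset.mem_image₂_of_mem (hLU x (mem_support_restrict.2 ⟨hx, hxL⟩)) hy)
      · exact Finset.mem_union_left _
          (hconv' αR hRsupp x (mem_support_restrict.2 ⟨hx, hxL⟩) y hy)

/-- Every finite set is contained in a finite set which is convex for `γ`. -/
lemma LocInd.exists_convex (hQ : LocInd Q) {γ : MonoidAlgebra ℚ Q} (hγ : γ ≠ 0)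
    (E₀ : Finset Q) : ∃ E, E₀ ⊆ E ∧ IsConvexFor γ E := by
  classical
  have := hQ.uniqueProds
  induction hn : γ.coeff.support.card using Nat.strong_induction_on generalizing γ E₀ with
  | _ n ih =>
    have hne : γ.coeff.support.Nonempty := by simpa [Finsupp.support_nonempty_iff] using hγ
    rcases γ.coeff.support.eq_singleton_or_nontrivial hne.choose_spec with hC | hC
    · refine ⟨E₀, subset_rfl, fun α hα x hx y hy => hα ?_⟩
      rw [Finsupp.mem_support_iff, MonoidAlgebra.coeff_mul_mul_of_uniqueMul]
      · exact mul_ne_zero (Finsupp.mem_support_iff.1 hx) (Finsupp.mem_support_iff.1 hy)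
      · intro a b ha hb hab
        rw [hC, Finset.mem_singleton] at hb hy
        rw [hb, hy] at hab ⊢
        exact ⟨mul_right_cancel hab, rfl⟩
    · obtain ⟨g, h, f, hg, y, hy, z, hz, hyz⟩ := hQ.exists_right hC
      obtain ⟨c, hc, hmax⟩ := γ.coeff.support.exists_max_image f hne
      set γt := restrict γ (fun y => f y = f c) with hγt
      have hct : c ∈ γt.coeff.support := mem_support_restrict.2 ⟨hc, rfl⟩
      have hlt : γt.coeff.support.card < n := by
        rw [← hn]
        refine Finset.card_lt_card ⟨fun x hx => (mem_support_restrict.1 hx).1, fun hss => ?_⟩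
        have h1 := (mem_support_restrict.1 (hss hy)).2
        have h2 := hmax z hz
        omega
      have hγt0 : γt ≠ 0 := by intro h0; rw [h0] at hct; simp at hct
      set M : ℕ := E₀.sup fun z => (g z).natAbs with hM
      obtain ⟨E, hE, -, hconv⟩ := exists_convex_step hγ hg hmax hγt hct
        (fun E₀ => ih _ hlt hγt0 E₀ rfl) (-M) (2 * M + 1) E₀ (by
          intro z hz
          have : (g z).natAbs ≤ M := Finset.le_sup (f := fun z => (g z).natAbs) hz
          push_cast
          omega)
      exact ⟨E, hE, hconv⟩

end Convex

end RatDerived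

namespace RatDerived

open scoped commutatorElement

section Abelianization

variable {E E' : Type*}

lemma ab_map (f : E → E') (u : FreeGroup E) :
    ab (FreeGroup.map f u) = Finsupp.mapDomain f (ab u) := by
  induction u using FreeGroup.induction_on with
  | C1 => simp
  | of e => simp
  | inv_of e h => rw [map_inv, ab_inv, h, ab_inv, ← Finsupp.mapDomain.addMonoidHom_apply,
      ← Finsupp.mapDomain.addMonoidHom_apply, map_neg]
  | mul u v hu hv => rw [map_mul, ab_mul, hu, hv, ab_mul, Finsupp.mapDomain_add]

lemma exists_int_eq_ab (u : FreeGroup E) :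
    ∃ z : E →₀ ℤ, ab u = z.mapRange (fun n : ℤ => (n : ℚ)) Int.cast_zero ∧
      z = FreeAbelianGroup.toFinsupp (Additive.ofMul (Abelianization.of u)) := by
  induction u using FreeGroup.induction_on with
  | C1 => exact ⟨0, by simp, (map_zero FreeAbelianGroup.toFinsupp).symm⟩
  | of e =>
    refine ⟨Finsupp.single e 1, by simp, ?_⟩
    exact (FreeAbelianGroup.toFinsupp_of e).symm
  | inv_of e h =>
    obtain ⟨z, h1, h2⟩ := h
    refine ⟨-z, ?_, ?_⟩
    · rw [ab_inv, h1]
      ext x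
      simp
    · rw [map_inv, ofMul_inv, h2]
      exact (map_neg FreeAbelianGroup.toFinsupp _).symm
  | mul u v hu hv =>
    obtain ⟨y, h1, h2⟩ := hu
    obtain ⟨z, h3, h4⟩ := hv
    refine ⟨y + z, ?_, ?_⟩
    · rw [ab_mul, h1, h3]
      ext x
      simp
    · rw [map_mul, ofMul_mul, h2, h4]
      exact (map_add FreeAbelianGroup.toFinsupp _ _).symm

lemma exists_int_ab (u : FreeGroup E) (e : E) : ∃ n : ℤ, ab u e = n := by
  obtain ⟨z, hz, -⟩ := exists_int_eq_ab u
  exact ⟨z e, by rw [hz]; simp⟩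

lemma mem_commutator_of_ab_eq_zero {u : FreeGroup E} (hu : ab u = 0) :
    u ∈ commutator (FreeGroup E) := by
  obtain ⟨z, h1, h2⟩ := exists_int_eq_ab u
  have hz : z = 0 := by
    ext x
    have := DFunLike.congr_fun (h1.symm.trans hu) x
    simpa using this
  rw [hz] at h2
  have h3 : FreeAbelianGroup.equivFinsupp E (Additive.ofMul (Abelianization.of u)) =
      FreeAbelianGroup.equivFinsupp E 0 := h2.symm.trans (map_zero _).symm
  rw [← Abelianization.ker_of]
  exact (FreeAbelianGroup.equivFinsupp E).injective h3

end Abelianization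

section Crossed

variable {S Q : Type*} [Group Q]

/-- Translation by a group element of the edges of the Cayley graph. -/
def sh : Q →* MulAut (FreeGroup (Q × S)) where
  toFun q := FreeGroup.freeGroupCongr (Equiv.prodCongr (Equiv.mulLeft q) (Equiv.refl S))
  map_one' := by
    apply MulEquiv.toMonoidHom_injective
    ext e
    simp
  map_mul' p q := by
    apply MulEquiv.toMonoidHom_injective
    ext ⟨x, s⟩
    simp [mul_assoc]

lemma sh_apply (q : Q) (u : FreeGroup (Q × S)) :
    sh q u = FreeGroup.map (fun e => (q * e.1, e.2)) u := rfl

@[simp] lemma sh_of (q : Q) (e : Q × S) :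
    sh q (FreeGroup.of e) = FreeGroup.of (q * e.1, e.2) := by
  simp [sh_apply]

lemma sh_sh (p q : Q) (u : FreeGroup (Q × S)) : sh p (sh q u) = sh (p * q) u := by
  rw [map_mul]; rfl

@[simp] lemma sh_one (u : FreeGroup (Q × S)) : sh (1 : Q) u = u := by
  rw [map_one]; rfl

variable (π : FreeGroup S →* Q)

/-- The lift of a group homomorphism to paths in the Cayley graph. -/
def pathHom : FreeGroup S →* FreeGroup (Q × S) ⋊[sh] Q :=
  FreeGroup.lift fun t => ⟨FreeGroup.of (1, t), π (FreeGroup.of t)⟩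

/-- The path starting at the identity vertex of the Cayley graph spelled by a word. -/
def κ (u : FreeGroup S) : FreeGroup (Q × S) := (pathHom π u).left

lemma pathHom_right (u : FreeGroup S) : (pathHom π u).right = π u := by
  have : (SemidirectProduct.rightHom).comp (pathHom π) = π := by
    ext t
    simp [pathHom]
  exact DFunLike.congr_fun this u

@[simp] lemma κ_of (t : S) : κ π (FreeGroup.of t) = FreeGroup.of (1, t) := by
  simp [κ, pathHom]

@[simp] lemma κ_one : κ π 1 = 1 := by simp [κ]

lemma κ_mul (u v : FreeGroup S) : κ π (u * v) = κ π u * sh (π u) (κ π v) := by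
  simp [κ, pathHom_right]

lemma κ_inv (u : FreeGroup S) : κ π u⁻¹ = sh (π u)⁻¹ (κ π u)⁻¹ := by
  simp [κ, pathHom_right]

lemma κ_mul_of_mem {u : FreeGroup S} (hu : π u = 1) (v : FreeGroup S) :
    κ π (u * v) = κ π u * κ π v := by
  rw [κ_mul, hu, sh_one]

lemma κ_conj {v : FreeGroup S} (hv : π v = 1) (g : FreeGroup S) :
    κ π (g * v * g⁻¹) = κ π g * sh (π g) (κ π v) * (κ π g)⁻¹ := by
  rw [κ_mul, κ_mul, κ_inv, map_mul, hv, mul_one, sh_sh, mul_inv_cancel, sh_one]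

lemma ab_sh (q : Q) (u : FreeGroup (Q × S)) :
    ab (sh q u) = Finsupp.mapDomain (fun e : Q × S => (q * e.1, e.2)) (ab u) := by
  rw [sh_apply, ab_map]

lemma sh_injective_edge (q : Q) : Function.Injective (fun e : Q × S => (q * e.1, e.2)) := by
  rintro ⟨a, s⟩ ⟨b, t⟩ h
  simpa using h

/-- The boundary of the class of a path. -/
lemma boundary_ab_sh_κ (q : Q) (u : FreeGroup S) :
    Finsupp.linearCombination ℚ (fun e : Q × S => Finsupp.single (e.1 * π (FreeGroup.of e.2))
      (1 : ℚ) - Finsupp.single e.1 1) (ab (sh q (κ π u))) =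
      Finsupp.single (q * π u) 1 - Finsupp.single q 1 := by
  induction u using FreeGroup.induction_on generalizing q with
  | C1 => simp
  | of t => simp
  | inv_of t h =>
    rw [κ_inv, sh_sh, map_inv, map_inv, ab_inv, map_neg, h]
    simp
  | mul u v hu hv =>
    rw [κ_mul, map_mul, ab_mul, map_add, sh_sh, hu, hv, map_mul, mul_assoc]
    abel

end Crossed

end RatDerived

namespace RatDerived

open scoped commutatorElement

section Section

variable {S Q : Type*} [Group Q] (π : FreeGroup S →* Q)

/-- The homomorphism sending each edge of the Cayley graph to the corresponding Schreier
generator of the kernel. -/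
def schreier (σ : Q → FreeGroup S) : FreeGroup (Q × S) →* FreeGroup S :=
  FreeGroup.lift fun e => σ e.1 * FreeGroup.of e.2 * (σ (e.1 * π (FreeGroup.of e.2)))⁻¹

lemma schreier_sh_κ (σ : Q → FreeGroup S) (q : Q) (u : FreeGroup S) :
    schreier π σ (sh q (κ π u)) = σ q * u * (σ (q * π u))⁻¹ := by
  induction u using FreeGroup.induction_on generalizing q with
  | C1 => simp
  | of t => simp [schreier]
  | inv_of t h =>
    rw [κ_inv, sh_sh, map_inv, map_inv, h, map_inv]
    simp [mul_assoc]
  | mul u v hu hv =>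
    rw [κ_mul, map_mul, sh_sh, map_mul, hu, hv, map_mul]
    group

lemma schreier_κ (σ : Q → FreeGroup S) {u : FreeGroup S} (hu : π u = 1) :
    schreier π σ (κ π u) = σ 1 * u * (σ 1)⁻¹ := by
  have := schreier_sh_κ π σ 1 u
  rwa [sh_one, hu, mul_one] at this

lemma eq_one_of_κ_eq_one {u : FreeGroup S} (hu : π u = 1) (h : κ π u = 1) : u = 1 := by
  have := schreier_κ π (fun _ => 1) hu
  rw [h] at this
  simpa using this.symm

lemma schreier_mem_ker {σ : Q → FreeGroup S} (hσ : ∀ q, π (σ q) = q) (g : FreeGroup (Q × S)) :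
    π (schreier π σ g) = 1 := by
  have : π.comp (schreier π σ) = 1 := by
    ext e
    simp [schreier, hσ]
  exact DFunLike.congr_fun this g

/-- An element of the kernel whose path is homologically trivial is a product of commutators
of elements of the kernel. -/
lemma mem_commutator_ker (hπ : Function.Surjective π) {u : FreeGroup S} (hu : π u = 1)
    (h : ab (κ π u) = 0) : u ∈ ⁅π.ker, π.ker⁆ := by
  obtain ⟨σ, hσ⟩ := hπ.hasRightInverse
  have h1 := Subgroup.mem_map_of_mem (schreier π σ) (mem_commutator_of_ab_eq_zero h)
  rw [commutator_def, Subgroup.map_commutator] at h1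
  have hle : Subgroup.map (schreier π σ) ⊤ ≤ π.ker := by
    rintro _ ⟨g, -, rfl⟩
    exact schreier_mem_ker π hσ g
  have h2 := Subgroup.commutator_mono hle hle h1
  rw [schreier_κ π σ hu] at h2
  have := Subgroup.Normal.conj_mem inferInstance _ h2 (σ 1)⁻¹
  simpa [mul_assoc] using this

/-- The normal closure of all lifts of a relator. -/
def relators (c : FreeGroup S) : Subgroup (FreeGroup (Q × S)) :=
  Subgroup.normalClosure (Set.range fun x : Q => sh x (κ π c))

instance (c : FreeGroup S) : (relators π c).Normal := Subgroup.normalClosure_normal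

lemma κ_mem_relators {c : FreeGroup S} (hc : π c = 1) {u : FreeGroup S}
    (hu : u ∈ Subgroup.normalClosure {c}) : κ π u ∈ relators π c := by
  suffices h : π u = 1 ∧ κ π u ∈ relators π c from h.2
  induction hu using Subgroup.closure_induction with
  | mem x hx =>
    obtain ⟨a, ha, hax⟩ := Group.mem_conjugatesOfSet_iff.1 hx
    rw [Set.mem_singleton_iff.1 ha] at hax
    obtain ⟨g, rfl⟩ := isConj_iff.1 hax
    refine ⟨by simp [hc], ?_⟩
    rw [κ_conj π hc]
    exact Subgroup.Normal.conj_mem inferInstance _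
      (Subgroup.subset_normalClosure (Set.mem_range_self (π g))) _
  | one => simp [one_mem]
  | mul x y _ _ hx hy =>
    refine ⟨by simp [hx.1, hy.1], ?_⟩
    rw [κ_mul_of_mem π hx.1]
    exact mul_mem hx.2 hy.2
  | inv x _ hx =>
    refine ⟨by simp [hx.1], ?_⟩
    rw [κ_inv, hx.1, inv_one, sh_one]
    exact inv_mem hx.2

lemma mem_normalClosure_of_κ_mem {c : FreeGroup S} (hc : π c = 1)
    {u : FreeGroup S} (hu : π u = 1) (h : κ π u ∈ relators π c)
    (hπ : Function.Surjective π) : u ∈ Subgroup.normalClosure {c} := by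
  obtain ⟨σ, hσ⟩ := hπ.hasRightInverse
  have hle : relators π c ≤ (Subgroup.normalClosure {c}).comap (schreier π σ) := by
    refine Subgroup.normalClosure_le_normal ?_
    rintro _ ⟨x, rfl⟩
    simp only [Subgroup.coe_comap, Set.mem_preimage, SetLike.mem_coe]
    rw [schreier_sh_κ, hc, mul_one]
    exact Subgroup.Normal.conj_mem inferInstance _
      (Subgroup.subset_normalClosure (Set.mem_singleton c)) _
  have h2 : schreier π σ (κ π u) ∈ Subgroup.normalClosure {c} := hle h
  rw [schreier_κ π σ hu] at h2
  have := Subgroup.Normal.conj_mem inferInstance _ h2 (σ 1)⁻¹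
  simpa [mul_assoc] using this

end Section

section Slice

variable {S Q : Type*}

lemma mk_right_injective (s : S) : Function.Injective fun q : Q => (q, s) :=
  fun _ _ h => (Prod.ext_iff.1 h).1

/-- The part of a chain consisting of the edges with a given label. -/
noncomputable def slice (s : S) (a : Q × S →₀ ℚ) : MonoidAlgebra ℚ Q :=
  .ofCoeff (a.comapDomain (fun q => (q, s)) (mk_right_injective s).injOn)

@[simp] lemma coeff_slice (s : S) (a : Q × S →₀ ℚ) (q : Q) : (slice s a).coeff q = a (q, s) := rfl

@[simp] lemma slice_zero (s : S) : slice s (0 : Q × S →₀ ℚ) = 0 := by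
  ext q; simp

lemma slice_add (s : S) (a b : Q × S →₀ ℚ) : slice s (a + b) = slice s a + slice s b := by
  ext q; simp

lemma slice_neg (s : S) (a : Q × S →₀ ℚ) : slice s (-a) = -slice s a := by
  ext q; simp

lemma slice_smul (s : S) (t : ℚ) (a : Q × S →₀ ℚ) : slice s (t • a) = t • slice s a := by
  ext q; simp

lemma slice_ext {a b : Q × S →₀ ℚ} (h : ∀ s, slice s a = slice s b) : a = b := by
  ext ⟨q, s⟩
  rw [← coeff_slice, h, coeff_slice]

variable [Group Q] (π : FreeGroup S →* Q)

lemma slice_ab_sh (s : S) (q : Q) (u : FreeGroup (Q × S)) :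
    slice s (ab (sh q u)) = MonoidAlgebra.single q 1 * slice s (ab u) := by
  ext x
  rw [coeff_slice, ab_sh]
  have : (x, s) = (fun e : Q × S => (q * e.1, e.2)) (q⁻¹ * x, s) := by simp
  rw [this, Finsupp.mapDomain_apply (sh_injective_edge q)]
  simp [MonoidAlgebra.coeff_single_mul_apply]

/-- Up to commutators, the kernel elements normally generated by `w` have chains which are
multiples of the chain of `w`. -/
lemma exists_slice_eq_mul {w : FreeGroup S} (hw : π w = 1) {u : FreeGroup S}
    (hu : u ∈ ⁅π.ker, π.ker⁆ ⊔ Subgroup.normalClosure {w}) :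
    ∃ α : MonoidAlgebra ℚ Q, ∀ s, slice s (ab (κ π u)) = α * slice s (ab (κ π w)) := by
  let M : Subgroup (FreeGroup S) :=
    { carrier := {v | π v = 1 ∧ ∃ α : MonoidAlgebra ℚ Q, ∀ s,
        slice s (ab (κ π v)) = α * slice s (ab (κ π w))}
      one_mem' := ⟨map_one π, 0, by simp⟩
      mul_mem' := by
        rintro a b ⟨ha, α, hα⟩ ⟨hb, β, hβ⟩
        refine ⟨by simp [ha, hb], α + β, fun s => ?_⟩
        rw [κ_mul_of_mem π ha, ab_mul, slice_add, hα, hβ, add_mul]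
      inv_mem' := by
        rintro a ⟨ha, α, hα⟩
        refine ⟨by simp [ha], -α, fun s => ?_⟩
        rw [κ_inv, ha, inv_one, sh_one, ab_inv, slice_neg, hα, neg_mul] }
  suffices h : ⁅π.ker, π.ker⁆ ⊔ Subgroup.normalClosure {w} ≤ M from (h hu).2
  refine sup_le (Subgroup.commutator_le.2 fun a ha b hb => ?_) ((Subgroup.closure_le _).2 ?_)
  · rw [MonoidHom.mem_ker] at ha hb
    refine ⟨by simp [commutatorElement_def, ha, hb], 0, fun s => ?_⟩
    have : κ π ⁅a, b⁆ = κ π a * κ π b * (κ π a)⁻¹ * (κ π b)⁻¹ := by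
      rw [commutatorElement_def, κ_mul_of_mem π (by simp [ha, hb]),
        κ_mul_of_mem π (by simp [ha, hb]), κ_mul_of_mem π ha, κ_inv, κ_inv, ha, hb]
      simp
    rw [this]
    simp
  · intro x hx
    obtain ⟨a, ha, hax⟩ := Group.mem_conjugatesOfSet_iff.1 hx
    rw [Set.mem_singleton_iff.1 ha] at hax
    obtain ⟨g, rfl⟩ := isConj_iff.1 hax
    refine ⟨by simp [hw], MonoidAlgebra.single (π g) 1, fun s => ?_⟩
    rw [κ_conj π hw, ab_mul, ab_mul, ab_inv, ← slice_ab_sh]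
    congr 1
    abel

end Slice

end RatDerived

namespace RatDerived

section Words

variable {E : Type*}

lemma mk_mem_closure {Y : Set E} {L : List (E × Bool)} (h : ∀ o ∈ L, o.1 ∈ Y) :
    FreeGroup.mk L ∈ Subgroup.closure (FreeGroup.of '' Y) := by
  induction L with
  | nil => exact one_mem _
  | cons o L ih =>
    rw [← List.singleton_append, ← FreeGroup.mul_mk]
    refine mul_mem ?_ (ih fun o ho => h o (List.mem_cons_of_mem _ ho))
    have ho : FreeGroup.of o.1 ∈ Subgroup.closure (FreeGroup.of '' Y) :=
      Subgroup.subset_closure ⟨_, h o List.mem_cons_self, rfl⟩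
    rcases o with ⟨e, _ | _⟩
    · exact inv_mem ho
    · exact ho

lemma exists_finset_mem_closure (g : FreeGroup E) :
    ∃ B : Finset E, g ∈ Subgroup.closure (FreeGroup.of '' (B : Set E)) := by
  classical
  refine ⟨(g.toWord.map Prod.fst).toFinset, ?_⟩
  rw [← FreeGroup.mk_toWord (x := g)]
  refine mk_mem_closure fun o ho => ?_
  simp only [List.coe_toFinset, FreeGroup.mk_toWord, Set.mem_ofPred_eq, List.mem_map]
  exact ⟨o, ho, rfl⟩

lemma closure_le_of_relator {R : Subgroup (FreeGroup E)} {Y : Set E} {e : E} {b : Bool}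
    {A B : List (E × Bool)} (hR : FreeGroup.mk (A ++ (e, b) :: B) ∈ R)
    (hA : ∀ o ∈ A, o.1 ∈ Y \ {e}) (hB : ∀ o ∈ B, o.1 ∈ Y \ {e}) :
    Subgroup.closure (FreeGroup.of '' Y) ≤ Subgroup.closure (FreeGroup.of '' (Y \ {e})) ⊔ R := by
  set H := Subgroup.closure (FreeGroup.of '' (Y \ {e})) ⊔ R
  have hA' : FreeGroup.mk A ∈ H := Subgroup.mem_sup_left (mk_mem_closure hA)
  have hB' : FreeGroup.mk B ∈ H := Subgroup.mem_sup_left (mk_mem_closure hB)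
  have hR' : FreeGroup.mk A * (FreeGroup.mk [(e, b)] * FreeGroup.mk B) ∈ H := by
    rw [FreeGroup.mul_mk, FreeGroup.mul_mk, List.singleton_append]
    exact Subgroup.mem_sup_right hR
  have he : FreeGroup.mk [(e, b)] ∈ H := by
    rwa [Subgroup.mul_mem_cancel_left _ hA', Subgroup.mul_mem_cancel_right _ hB'] at hR'
  have he' : FreeGroup.of e ∈ H := by
    cases b
    · exact inv_mem_iff.1 he
    · exact he
  rw [Subgroup.closure_le]
  rintro _ ⟨y, hy, rfl⟩
  by_cases hye : y = e
  · rw [hye]; exact he'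
  · exact Subgroup.mem_sup_left (Subgroup.subset_closure ⟨y, ⟨hy, hye⟩, rfl⟩)

/-- The sign of an orientation. -/
def bsign (b : Bool) : ℚ := if b then 1 else -1

lemma bsign_ne_zero (b : Bool) : bsign b ≠ 0 := by cases b <;> simp [bsign]

lemma ab_mk_singleton (o : E × Bool) :
    ab (FreeGroup.mk [o]) = Finsupp.single o.1 (bsign o.2) := by
  rcases o with ⟨e, _ | _⟩
  · change ab (FreeGroup.of e)⁻¹ = _
    simp [bsign]
  · change ab (FreeGroup.of e) = _
    simp [bsign]

lemma ab_mk_cons (o : E × Bool) (L : List (E × Bool)) :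
    ab (FreeGroup.mk (o :: L)) = Finsupp.single o.1 (bsign o.2) + ab (FreeGroup.mk L) := by
  rw [← List.singleton_append, ← FreeGroup.mul_mk, ab_mul, ab_mk_singleton]

lemma ab_mk_apply_of_notMem {L : List (E × Bool)} {e : E} (h : e ∉ L.map Prod.fst) :
    ab (FreeGroup.mk L) e = 0 := by
  induction L with
  | nil => rw [← FreeGroup.one_eq_mk, ab_one, Finsupp.coe_zero, Pi.zero_apply]
  | cons o L ih =>
    simp only [List.map_cons, List.mem_cons, not_or] at h
    rw [ab_mk_cons, Finsupp.add_apply, ih h.2, Finsupp.single_eq_of_ne h.1, add_zero]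

lemma ab_mk_apply_of_mem {L : List (E × Bool)} (hL : (L.map Prod.fst).Nodup) {o : E × Bool}
    (h : o ∈ L) : ab (FreeGroup.mk L) o.1 = bsign o.2 := by
  induction L with
  | nil => simp at h
  | cons p L ih =>
    rw [List.map_cons, List.nodup_cons] at hL
    rw [ab_mk_cons, Finsupp.add_apply]
    rcases List.mem_cons.1 h with rfl | h
    · rw [ab_mk_apply_of_notMem hL.1, Finsupp.single_eq_same, add_zero]
    · have hne : o.1 ≠ p.1 := by
        intro h'
        exact hL.1 (h' ▸ List.mem_map_of_mem h)
      rw [ih hL.2 h, Finsupp.single_eq_of_ne hne, zero_add]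

end Words

section EdgeList

variable {S Q : Type*} [Group Q] (π : FreeGroup S →* Q)

/-- The oriented edges traversed by the path with given initial vertex spelled by a word. -/
def edges (q : Q) : List (S × Bool) → List ((Q × S) × Bool)
  | [] => []
  | (t, true) :: L => ((q, t), true) :: edges (q * π (FreeGroup.of t)) L
  | (t, false) :: L => ((q * (π (FreeGroup.of t))⁻¹, t), false) ::
      edges (q * (π (FreeGroup.of t))⁻¹) L

lemma sh_κ_mk (q : Q) (L : List (S × Bool)) :
    sh q (κ π (FreeGroup.mk L)) = FreeGroup.mk (edges π q L) := by
  induction L generalizing q with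
  | nil =>
    rw [← FreeGroup.one_eq_mk, κ_one, map_one]
    rfl
  | cons o L ih =>
    rw [← List.singleton_append, ← FreeGroup.mul_mk, κ_mul, map_mul, sh_sh, ih]
    rcases o with ⟨t, _ | _⟩
    · change sh q (κ π (FreeGroup.of t)⁻¹) * FreeGroup.mk (edges π (q * π (FreeGroup.of t)⁻¹) L) = _
      rw [κ_inv, sh_sh, κ_of, map_inv, sh_of, mul_one, map_inv]
      rfl
    · change sh q (κ π (FreeGroup.of t)) * FreeGroup.mk (edges π (q * π (FreeGroup.of t)) L) = _
      rw [κ_of, sh_of, mul_one]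
      rfl

lemma edges_mul (p q : Q) (L : List (S × Bool)) :
    edges π (p * q) L = (edges π q L).map fun o => ((p * o.1.1, o.1.2), o.2) := by
  induction L generalizing q with
  | nil => rfl
  | cons o L ih =>
    rcases o with ⟨t, _ | _⟩ <;> simp [edges, mul_assoc, ih]

lemma map_fst_edges_mul (p q : Q) (L : List (S × Bool)) :
    (edges π (p * q) L).map Prod.fst =
      ((edges π q L).map Prod.fst).map fun e => (p * e.1, e.2) := by
  rw [edges_mul]
  simp

lemma nodup_edges (q : Q) {L : List (S × Bool)} (h : ((edges π 1 L).map Prod.fst).Nodup) :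
    ((edges π q L).map Prod.fst).Nodup := by
  rw [← mul_one q, map_fst_edges_mul]
  exact h.map (sh_injective_edge q)

lemma mem_edges_mul {p : Q} {e : Q × S} {L : List (S × Bool)} :
    e ∈ (edges π p L).map Prod.fst ↔ (p⁻¹ * e.1, e.2) ∈ (edges π 1 L).map Prod.fst := by
  have := map_fst_edges_mul π p 1 L
  rw [mul_one] at this
  rw [this, List.mem_map]
  constructor
  · rintro ⟨a, ha, rfl⟩
    simpa using ha
  · intro h
    exact ⟨_, h, by simp⟩

lemma coeff_slice_ne_zero_iff {L : List (S × Bool)} (h : ((edges π 1 L).map Prod.fst).Nodup)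
    (s : S) (q : Q) : (slice s (ab (κ π (FreeGroup.mk L)))).coeff q ≠ 0 ↔
      (q, s) ∈ (edges π 1 L).map Prod.fst := by
  rw [coeff_slice, ← sh_one (κ π (FreeGroup.mk L)), sh_κ_mk]
  constructor
  · intro h'
    by_contra h2
    exact h' (ab_mk_apply_of_notMem h2)
  · rw [List.mem_map]
    rintro ⟨o, ho, h2⟩
    rw [← h2, ab_mk_apply_of_mem h ho]
    exact bsign_ne_zero _

end EdgeList

section Elimination

variable {S Q : Type*} [Group Q] (π : FreeGroup S →* Q)

/-- Relators in finitely many translates can be used to eliminate some of the generators they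
involve, in such a way that the relators become linearly independent modulo the others. -/
lemma exists_elimination [UniqueProds Q] {L : List (S × Bool)}
    (hL : ((edges π 1 L).map Prod.fst).Nodup) {s : S}
    (hs : slice s (ab (κ π (FreeGroup.mk L))) ≠ 0) (X : Finset Q) :
    ∃ T : Set Q, (∀ Y : Set (Q × S), (∀ x ∈ X, ∀ e ∈ (edges π x L).map Prod.fst, e ∈ Y) →
        Subgroup.closure (FreeGroup.of '' Y) ≤
          Subgroup.closure (FreeGroup.of '' (Y \ {e | e.2 = s ∧ e.1 ∈ T})) ⊔
            relators π (FreeGroup.mk L)) ∧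
      ∀ α : MonoidAlgebra ℚ Q, α.coeff.support ⊆ X →
        (∀ q ∈ T, (α * slice s (ab (κ π (FreeGroup.mk L)))).coeff q = 0) → α = 0 := by
  classical
  set γ := slice s (ab (κ π (FreeGroup.mk L))) with hγ
  induction hn : X.card using Nat.strong_induction_on generalizing X with
  | _ n ih =>
  rcases X.eq_empty_or_nonempty with rfl | hX
  · refine ⟨∅, fun Y _ => ?_, fun α hα _ => ?_⟩
    · simp
    · rwa [Finset.subset_empty, Finsupp.support_eq_empty, MonoidAlgebra.coeff_eq_zero] at hα
  have hC : γ.coeff.support.Nonempty := by simpa [Finsupp.support_nonempty_iff] using hs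
  obtain ⟨x, hx, q, hq, hu⟩ := UniqueProds.uniqueMul_of_nonempty hX hC
  obtain ⟨T, hT1, hT2⟩ := ih _ (hn ▸ Finset.card_erase_lt_of_mem hx) (X.erase x) rfl
  have hmem : ∀ q, q ∈ γ.coeff.support ↔ (q, s) ∈ (edges π 1 L).map Prod.fst := fun q => by
    rw [Finsupp.mem_support_iff, hγ, coeff_slice_ne_zero_iff π hL]
  refine ⟨insert (x * q) T, fun Y hY => ?_, fun α hα h0 => ?_⟩
  · have hset : Y \ {e : Q × S | e.2 = s ∧ e.1 ∈ insert (x * q) T} =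
        (Y \ {(x * q, s)}) \ {e | e.2 = s ∧ e.1 ∈ T} := by
      ext ⟨p, t⟩
      simp only [Set.mem_insert_iff, Set.mem_sdiff, Set.mem_ofPred_eq, Set.mem_singleton_iff,
        Prod.mk.injEq]
      tauto
    rw [hset]
    have he : (x * q, s) ∈ (edges π x L).map Prod.fst := by
      rw [mem_edges_mul]
      simpa using (hmem q).1 hq
    obtain ⟨⟨e, b⟩, ho, rfl : e = (x * q, s)⟩ := List.mem_map.1 he
    obtain ⟨A, B, hAB⟩ := List.append_of_mem ho
    have hnd := nodup_edges π x hL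
    have hYx := hY x hx
    rw [hAB, List.map_append, List.map_cons] at hnd hYx
    rw [List.nodup_middle, List.nodup_cons, List.mem_append, not_or] at hnd
    have hstep : Subgroup.closure (FreeGroup.of '' Y) ≤
        Subgroup.closure (FreeGroup.of '' (Y \ {(x * q, s)})) ⊔ relators π (FreeGroup.mk L) := by
      refine closure_le_of_relator (A := A) (B := B) (b := b) ?_ ?_ ?_
      · rw [← hAB, ← sh_κ_mk]
        exact Subgroup.subset_normalClosure ⟨x, rfl⟩
      · intro o ho
        refine ⟨hYx _ ?_, fun h => hnd.1.1 (Set.mem_singleton_iff.1 h ▸ List.mem_map.2 ⟨o, ho, rfl⟩)⟩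
        exact List.mem_append_left _ (List.mem_map_of_mem ho)
      · intro o ho
        refine ⟨hYx _ ?_, fun h => hnd.1.2 (Set.mem_singleton_iff.1 h ▸ List.mem_map.2 ⟨o, ho, rfl⟩)⟩
        exact List.mem_append_right _ (List.mem_cons_of_mem _ (List.mem_map_of_mem ho))
    refine hstep.trans (sup_le (hT1 _ fun y hy e he => ⟨hY y (Finset.mem_of_mem_erase hy) e he, ?_⟩)
      le_sup_right)
    rintro rfl
    rw [mem_edges_mul] at he
    have := hu (Finset.mem_of_mem_erase hy) ((hmem _).2 he) (by simp)
    exact Finset.ne_of_mem_erase hy this.1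
  · have h1 : α.coeff x * γ.coeff q = 0 := by
      rw [← MonoidAlgebra.coeff_mul_mul_of_uniqueMul (hu.mono hα subset_rfl)]
      exact h0 _ (Set.mem_insert _ _)
    have h2 : α.coeff x = 0 := (mul_eq_zero.1 h1).resolve_right (Finsupp.mem_support_iff.1 hq)
    refine hT2 α (fun y hy => Finset.mem_erase.2 ⟨?_, hα hy⟩) fun q hq =>
      h0 q (Set.mem_insert_of_mem _ hq)
    rintro rfl
    exact Finsupp.mem_support_iff.1 hy h2

end Elimination

end RatDerived

namespace RatDerived

section Independence

variable {S Q : Type*} [Group Q]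

lemma slice_linearCombination (s : S) (c : FreeGroup (Q × S)) (l : Q →₀ ℚ) :
    slice s (Finsupp.linearCombination ℚ (fun x : Q => ab (sh x c)) l) =
      MonoidAlgebra.ofCoeff l * slice s (ab c) := by
  induction l using Finsupp.induction_linear with
  | zero => simp
  | add f g hf hg => rw [map_add, slice_add, hf, hg, MonoidAlgebra.ofCoeff_add, add_mul]
  | single x t =>
    rw [Finsupp.linearCombination_single, slice_smul, slice_ab_sh, ← smul_mul_assoc]
    congr 1
    ext y
    simp

lemma linearIndependent_relators [UniqueProds Q] {c : FreeGroup (Q × S)} {s : S}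
    (hs : slice s (ab c) ≠ 0) {J : Set (Q × S)}
    (hJ : ∀ α : MonoidAlgebra ℚ Q, (∀ q, (q, s) ∉ J → (α * slice s (ab c)).coeff q = 0) → α = 0) :
    LinearIndependent ℚ
      (Sum.elim (fun x : Q => ab (sh x c)) fun e : J => Finsupp.single (e : Q × S) (1 : ℚ)) := by
  refine LinearIndependent.sum_type ?_ ?_ ?_
  · rw [linearIndependent_iff]
    intro l hl
    have := congrArg (slice s) hl
    rw [slice_linearCombination, slice_zero] at this
    have h2 := (mul_eq_zero.1 this).resolve_right hs
    simpa using congrArg MonoidAlgebra.coeff h2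
  · exact (Finsupp.basisSingleOne (R := ℚ) (ι := Q × S)).linearIndependent.comp
      (fun e : J => (e : Q × S)) Subtype.val_injective
  · rw [Submodule.disjoint_def]
    intro z hz1 hz2
    obtain ⟨l, rfl⟩ := Finsupp.mem_span_range_iff_exists_finsupp.1 hz1
    have hle : Submodule.span ℚ (Set.range fun e : J => Finsupp.single (e : Q × S) (1 : ℚ)) ≤
        Finsupp.supported ℚ ℚ J := by
      rw [Submodule.span_le]
      rintro _ ⟨e, rfl⟩
      exact Finsupp.single_mem_supported ℚ 1 e.2
    have hsup := (Finsupp.mem_supported' ℚ _).1 (hle hz2)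
    have hl : (l.sum fun x t => t • ab (sh x c)) =
        Finsupp.linearCombination ℚ (fun x : Q => ab (sh x c)) l := rfl
    rw [hl] at hsup ⊢
    have h0 : MonoidAlgebra.ofCoeff l = 0 := by
      refine hJ _ fun q hq => ?_
      rw [← slice_linearCombination, coeff_slice]
      exact hsup _ hq
    have h1 : l = 0 := by simpa using congrArg MonoidAlgebra.coeff h0
    rw [h1, map_zero]

end Independence

section Residual

variable {S Q : Type*} [Group Q] (π : FreeGroup S →* Q)

/-- A criterion for an element not to lie in all the terms of the rational derived series. -/
lemma notMem_iInf_pre {K : Subgroup (FreeGroup S)} [K.Normal] {n : ℕ} (hker : π.ker = pre K n)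
    {X : Type*} (c : X → FreeGroup (Q × S))
    (hK : ∀ v ∈ K, κ π v ∈ Subgroup.normalClosure (Set.range c)) {J : Set (Q × S)}
    (hli : LinearIndependent ℚ
      (Sum.elim (fun x => ab (c x)) (fun e : J => Finsupp.single (e : Q × S) (1 : ℚ))))
    {u : FreeGroup S} {g : FreeGroup (Q × S)}
    (hg : g ∈ Subgroup.closure (FreeGroup.of '' J)) (hg1 : g ≠ 1)
    (hug : κ π u * g⁻¹ ∈ Subgroup.normalClosure (Set.range c)) : u ∉ ⨅ i, pre K i := by
  intro hu
  obtain ⟨m, f, hf, hfg⟩ := exists_lift_ne_one hg1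
  obtain ⟨ρ, h1, hJ, hc⟩ := (matrixFiltration m).exists_lift_eq_one c J hli f hf
  have hle : Subgroup.normalClosure (Set.range c) ≤ (FreeGroup.lift ρ).ker := by
    refine Subgroup.normalClosure_le_normal ?_
    rintro _ ⟨x, rfl⟩
    exact hc x
  have hρg : FreeGroup.lift ρ g = FreeGroup.lift f g := by
    refine MonoidHom.eqOn_closure (f := FreeGroup.lift ρ) (g := FreeGroup.lift f) ?_ hg
    rintro _ ⟨e, he, rfl⟩
    simpa using hJ e he
  have hρu : FreeGroup.lift ρ (κ π u) = FreeGroup.lift f g := by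
    have := MonoidHom.mem_ker.1 (hle hug)
    rwa [map_mul, map_inv, mul_inv_eq_one, hρg] at this
  have hmem : ∀ i, u ∈ pre K i := fun i => (Subgroup.mem_iInf.1 hu) i
  let φ : pre K n →* (Matrix (Fin (m + 1)) (Fin (m + 1)) ℚ)ˣ :=
    { toFun := fun v => FreeGroup.lift ρ (κ π v)
      map_one' := by simp
      map_mul' := fun a b => by
        have ha : π (a : FreeGroup S) = 1 := by
          rw [← MonoidHom.mem_ker, hker]
          exact a.2
        rw [Subgroup.coe_mul, κ_mul_of_mem π ha, map_mul] }
  have hU := (matrixFiltration m).mem_U_of_mem_pre φ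
    (fun v => (matrixFiltration m).lift_mem_U h1 _) (fun v hv => hle (hK _ hv))
    (matrixFiltration m).N ⟨u, hmem n⟩ (hmem _)
  have h2 := (matrixFiltration m).U_N ((matrixFiltration m).U_anti (Nat.le_succ _) hU)
  exact hfg (hρu.symm.trans h2)

/-- Free groups are residually rationally solvable. -/
lemma iInf_pre_one : ⨅ i, pre (Subgroup.normalClosure {(1 : FreeGroup S)}) i = ⊥ := by
  rw [eq_bot_iff]
  intro u hu
  rw [Subgroup.mem_bot]
  by_contra hne
  let π : FreeGroup S →* Unit := 1
  refine notMem_iInf_pre π (n := 0) (by ext; simp [π, pre_zero])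
    (fun x : Empty => x.elim) ?_ (J := Set.univ) ?_ (g := κ π u) ?_ ?_ ?_ hu
  · intro v hv
    have h1 : v = 1 := by
      have : Subgroup.normalClosure {(1 : FreeGroup S)} ≤ ⊥ :=
        Subgroup.normalClosure_le_normal (by simp)
      exact Subgroup.mem_bot.1 (this hv)
    rw [h1, κ_one]
    exact one_mem _
  · refine LinearIndependent.sum_type linearIndependent_empty_type ?_ ?_
    · exact (Finsupp.basisSingleOne (R := ℚ) (ι := Unit × S)).linearIndependent.comp
        (fun e : (Set.univ : Set (Unit × S)) => (e : Unit × S)) Subtype.val_injective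
    · rw [Set.range_eq_empty, Submodule.span_empty]
      exact disjoint_bot_left
  · rw [Set.image_univ, FreeGroup.closure_range_of]
    exact Subgroup.mem_top _
  · exact fun h => hne (eq_one_of_κ_eq_one π rfl h)
  · simp [one_mem]

/-- One-relator groups whose relator traverses a simple closed path in the Cayley graph of a
locally indicable quotient by a term of the series are residually rationally solvable. -/
lemma iInf_pre_eq_normalClosure (hQ : LocInd Q) (hπ : Function.Surjective π)
    {L : List (S × Bool)} (hne : L ≠ []) (hL : ((edges π 1 L).map Prod.fst).Nodup)
    (h1 : π (FreeGroup.mk L) = 1) {n : ℕ}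
    (hker : π.ker = pre (Subgroup.normalClosure {FreeGroup.mk L}) n) :
    ⨅ i, pre (Subgroup.normalClosure {FreeGroup.mk L}) i =
      Subgroup.normalClosure {FreeGroup.mk L} := by
  classical
  have := hQ.uniqueProds
  refine le_antisymm (fun u hu => ?_) (le_iInf fun i => le_pre i)
  have hu1 : π u = 1 := by
    rw [← MonoidHom.mem_ker, hker]
    exact (Subgroup.mem_iInf.1 hu) n
  refine mem_normalClosure_of_κ_mem π h1 hu1 ?_ hπ
  by_contra hnot
  obtain ⟨⟨q₀, s⟩, hs⟩ : ∃ e, e ∈ (edges π 1 L).map Prod.fst := by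
    rcases L with - | ⟨⟨t, _ | _⟩, L⟩
    · exact absurd rfl hne
    · exact ⟨_, List.mem_cons_self⟩
    · exact ⟨_, List.mem_cons_self⟩
  set γ := slice s (ab (κ π (FreeGroup.mk L))) with hγ
  have hq₀ : q₀ ∈ γ.coeff.support := by
    rw [Finsupp.mem_support_iff, hγ, coeff_slice_ne_zero_iff π hL]
    exact hs
  have hγ0 : γ ≠ 0 := by
    rintro h
    rw [h] at hq₀
    simp at hq₀
  obtain ⟨B, hB⟩ := exists_finset_mem_closure (κ π u)
  obtain ⟨E₁, hE₀, hconv⟩ := hQ.exists_convex hγ0 (B.image Prod.fst)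
  let X := (E₁.image fun z => z * q₀⁻¹).filter fun x => ∀ y ∈ γ.coeff.support, x * y ∈ E₁
  obtain ⟨T, hT1, hT2⟩ := exists_elimination π hL hγ0 X
  let Y : Set (Q × S) := {e | e.2 = s → e.1 ∈ E₁}
  have hY := hT1 Y (by
    rintro x hx ⟨p, t⟩ he (rfl : t = s)
    rw [mem_edges_mul] at he
    have := (Finset.mem_filter.1 hx).2 (x⁻¹ * p) (by
      rw [Finsupp.mem_support_iff, hγ, coeff_slice_ne_zero_iff π hL]
      exact he)
    simpa using this)
  have hgY : κ π u ∈ Subgroup.closure (FreeGroup.of '' Y) := by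
    refine Subgroup.closure_mono (Set.image_mono fun e he _ => ?_) hB
    exact hE₀ (Finset.mem_image_of_mem _ he)
  obtain ⟨g, hg, z, hz, hgz⟩ := Subgroup.mem_sup_of_normal_right.1 (hY hgY)
  refine notMem_iInf_pre π hker (fun x : Q => sh x (κ π (FreeGroup.mk L)))
    (fun v hv => κ_mem_relators π h1 hv)
    (linearIndependent_relators (s := s) hγ0 fun α hα => ?_) hg ?_ ?_ hu
  · have hsupp : (α * γ).coeff.support ⊆ E₁ := by
      intro q hq
      by_contra hqE
      exact Finsupp.mem_support_iff.1 hq (hα q fun h => hqE (h.1 rfl))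
    refine hT2 α (fun x hx => ?_) fun q hq => hα q fun h => h.2 ⟨rfl, hq⟩
    refine Finset.mem_filter.2 ⟨Finset.mem_image.2 ⟨x * q₀, hconv α hsupp x hx q₀ hq₀, ?_⟩,
      hconv α hsupp x hx⟩
    simp
  · rintro rfl
    rw [one_mul] at hgz
    exact hnot (hgz ▸ hz)
  · have : κ π u * g⁻¹ = g * z * g⁻¹ := by rw [← hgz]
    rw [this]
    exact Subgroup.Normal.conj_mem (inferInstanceAs (relators π (FreeGroup.mk L)).Normal) _ hz _

end Residual

end RatDerived

namespace RatDerived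

section Paths

variable {S Q : Type*} [Group Q] (π : FreeGroup S →* Q)

/-- The initial vertex of an oriented edge. -/
def src (o : (Q × S) × Bool) : Q :=
  if o.2 then o.1.1 else o.1.1 * π (FreeGroup.of o.1.2)

/-- The terminal vertex of an oriented edge. -/
def tgt (o : (Q × S) × Bool) : Q :=
  if o.2 then o.1.1 * π (FreeGroup.of o.1.2) else o.1.1

lemma src_eq_or_eq (e : Q × S) (b b' : Bool) :
    src π (e, b) = src π (e, b') ∨ src π (e, b) = tgt π (e, b') := by
  cases b <;> cases b' <;> simp [src, tgt]

lemma tgt_eq_or_eq (e : Q × S) (b b' : Bool) :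
    tgt π (e, b) = src π (e, b') ∨ tgt π (e, b) = tgt π (e, b') := by
  cases b <;> cases b' <;> simp [src, tgt]

lemma map_mk_true (t : S) : π (FreeGroup.mk [(t, true)]) = π (FreeGroup.of t) := rfl

lemma map_mk_false (t : S) : π (FreeGroup.mk [(t, false)]) = (π (FreeGroup.of t))⁻¹ :=
  map_inv π (FreeGroup.of t)

lemma map_mk_cons (o : S × Bool) (L : List (S × Bool)) :
    π (FreeGroup.mk (o :: L)) = π (FreeGroup.mk [o]) * π (FreeGroup.mk L) := by
  rw [← map_mul, FreeGroup.mul_mk, List.singleton_append]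

lemma map_mk_append (A B : List (S × Bool)) :
    π (FreeGroup.mk (A ++ B)) = π (FreeGroup.mk A) * π (FreeGroup.mk B) := by
  rw [← map_mul, FreeGroup.mul_mk]

lemma edges_append (q : Q) (A B : List (S × Bool)) :
    edges π q (A ++ B) = edges π q A ++ edges π (q * π (FreeGroup.mk A)) B := by
  induction A generalizing q with
  | nil => simp [edges, ← FreeGroup.one_eq_mk]
  | cons o A ih =>
    rw [map_mk_cons]
    rcases o with ⟨t, _ | _⟩ <;> simp [edges, ih, mul_assoc, map_mk_true, map_mk_false]

lemma length_edges (q : Q) (L : List (S × Bool)) : (edges π q L).length = L.length := by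
  induction L generalizing q with
  | nil => rfl
  | cons o L ih => rcases o with ⟨t, _ | _⟩ <;> simp [edges, ih]

lemma edges_src (o : (Q × S) × Bool) : edges π (src π o) [(o.1.2, o.2)] = [o] := by
  rcases o with ⟨⟨q, t⟩, _ | _⟩ <;> simp [edges, src]

lemma src_mul (o : (Q × S) × Bool) : src π o * π (FreeGroup.mk [(o.1.2, o.2)]) = tgt π o := by
  rcases o with ⟨⟨q, t⟩, _ | _⟩ <;> simp [src, tgt, map_mk_true, map_mk_false]

lemma exists_split_of_mem_edges {q : Q} {L : List (S × Bool)} {o : (Q × S) × Bool}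
    (ho : o ∈ edges π q L) : ∃ A l B, L = A ++ l :: B ∧ src π o = q * π (FreeGroup.mk A) ∧
      tgt π o = q * π (FreeGroup.mk (A ++ [l])) := by
  induction L generalizing q with
  | nil => simp [edges] at ho
  | cons l L ih =>
    have hcons : edges π q (l :: L) =
        edges π q [l] ++ edges π (q * π (FreeGroup.mk [l])) L := by
      rw [← edges_append, List.singleton_append]
    rw [hcons, List.mem_append] at ho
    rcases ho with ho | ho
    · refine ⟨[], l, L, rfl, ?_⟩
      rw [← FreeGroup.one_eq_mk, map_one, mul_one]
      rcases l with ⟨t, _ | _⟩ <;> simp only [edges, List.mem_singleton] at ho <;> subst ho <;>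
        simp [src, tgt, map_mk_true, map_mk_false]
    · obtain ⟨A, l', B, rfl, h1, h2⟩ := ih ho
      refine ⟨l :: A, l', B, rfl, ?_, ?_⟩
      · rw [h1, map_mk_cons π l A, mul_assoc]
      · rw [h2, List.cons_append, map_mk_cons π l (A ++ [l']), mul_assoc]

/-- A sequence of consecutive oriented edges is the sequence of edges of the word it spells. -/
lemma edges_of_chain (o : ℕ → (Q × S) × Bool) (ho : ∀ i, src π (o (i + 1)) = tgt π (o i))
    (j : ℕ) :
    edges π (src π (o 0)) ((List.range j).map fun i => ((o i).1.2, (o i).2)) =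
        (List.range j).map o ∧
      src π (o 0) * π (FreeGroup.mk ((List.range j).map fun i => ((o i).1.2, (o i).2))) =
        src π (o j) := by
  induction j with
  | zero => simp [edges, ← FreeGroup.one_eq_mk]
  | succ j ih =>
    rw [List.range_succ, List.map_append, List.map_append, edges_append, map_mk_append,
      ← mul_assoc, ih.1, ih.2]
    refine ⟨?_, ?_⟩
    · congr 1
      exact edges_src π (o j)
    · rw [ho]
      exact src_mul π (o j)

/-- A positive flow can be continued. -/
lemma exists_next {a : Q × S →₀ ℚ}
    (ha : Finsupp.linearCombination ℚ (fun e : Q × S =>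
      Finsupp.single (e.1 * π (FreeGroup.of e.2)) (1 : ℚ) - Finsupp.single e.1 1) a = 0)
    (o : {o : (Q × S) × Bool // 0 < bsign o.2 * a o.1}) :
    ∃ o' : {o : (Q × S) × Bool // 0 < bsign o.2 * a o.1}, src π o'.1 = tgt π o.1 := by
  classical
  by_contra! hno
  set v := tgt π o.1 with hv
  have h0 := DFunLike.congr_fun ha v
  rw [Finsupp.linearCombination_apply, Finsupp.sum, Finsupp.finsetSum_apply, Finsupp.coe_zero,
    Pi.zero_apply] at h0
  have key : ∀ (e : Q × S) (b : Bool), 0 < bsign b * a e →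
      (a e • (Finsupp.single (e.1 * π (FreeGroup.of e.2)) (1 : ℚ) - Finsupp.single e.1 1) :
        Q →₀ ℚ) v =
        if tgt π (e, b) = v then bsign b * a e else 0 := by
    intro e b hb
    have h1 := hno ⟨(e, b), hb⟩
    cases b
    · simp only [src, tgt, bsign, Bool.false_eq_true, if_false] at h1 ⊢
      simp only [Finsupp.smul_apply, Finsupp.sub_apply, Finsupp.single_apply, h1, if_false]
      split_ifs <;> simp
    · simp only [src, tgt, bsign, if_true] at h1 ⊢
      simp [Finsupp.single_apply, h1]
  have hpos : 0 < ∑ e ∈ a.support, (a e • (Finsupp.single (e.1 * π (FreeGroup.of e.2)) (1 : ℚ) -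
      Finsupp.single e.1 1) : Q →₀ ℚ) v := by
    refine Finset.sum_pos' (fun e he => ?_) ⟨o.1.1, ?_, ?_⟩
    · have hae := Finsupp.mem_support_iff.1 he
      obtain ⟨b, hb⟩ : ∃ b, 0 < bsign b * a e := by
        rcases lt_or_gt_of_ne hae with h | h
        · exact ⟨false, by simpa [bsign] using h⟩
        · exact ⟨true, by simpa [bsign] using h⟩
      rw [key e b hb]
      split_ifs
      · exact hb.le
      · exact le_rfl
    · rw [Finsupp.mem_support_iff]
      intro h
      have := o.2
      rw [h, mul_zero] at this
      exact lt_irrefl _ this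
    · rw [key _ _ o.2, if_pos rfl]
      exact o.2
  exact hpos.ne' h0

end Paths

end RatDerived

namespace RatDerived

section Cycle

lemma eq_of_bsign_mul_pos {b b' : Bool} {x : ℚ} (h : 0 < bsign b * x) (h' : 0 < bsign b' * x) :
    b = b' := by
  cases b <;> cases b' <;> simp only [bsign, if_true, Bool.false_eq_true, if_false] at h h' ⊢ <;>
    linarith

variable {S Q : Type*} [Group Q] (π : FreeGroup S →* Q)

/-- A positive flow contains a simple closed path. -/
lemma exists_cycle {a : Q × S →₀ ℚ} (ha0 : a ≠ 0)
    (ha : Finsupp.linearCombination ℚ (fun e : Q × S =>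
      Finsupp.single (e.1 * π (FreeGroup.of e.2)) (1 : ℚ) - Finsupp.single e.1 1) a = 0) :
    ∃ (o : ℕ → (Q × S) × Bool) (j : ℕ), 0 < j ∧ (∀ i, 0 < bsign (o i).2 * a (o i).1) ∧
      (∀ i, src π (o (i + 1)) = tgt π (o i)) ∧ (∀ i, o (i + j) = o i) ∧
      ∀ k, ((List.range j).map fun i => (o (k + i)).1).Nodup := by
  classical
  let O := {o : (Q × S) × Bool // 0 < bsign o.2 * a o.1}
  choose f hf using exists_next π ha
  have hfin : Finite O := by
    refine Finite.of_injective
      (fun o : O => (⟨o.1.1, ?_⟩, o.1.2) : O → {e // e ∈ a.support} × Bool) ?_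
    · rw [Finsupp.mem_support_iff]
      intro h
      have := o.2
      rw [h, mul_zero] at this
      exact lt_irrefl _ this
    · intro o o' h
      simp only [Prod.mk.injEq, Subtype.mk.injEq] at h
      exact Subtype.ext (Prod.ext h.1 h.2)
  have hne : ∃ o : O, True := by
    obtain ⟨e, he⟩ := Finsupp.support_nonempty_iff.2 ha0
    rcases lt_or_gt_of_ne (Finsupp.mem_support_iff.1 he) with h | h
    · exact ⟨⟨(e, false), by simpa [bsign] using h⟩, trivial⟩
    · exact ⟨⟨(e, true), by simpa [bsign] using h⟩, trivial⟩
  obtain ⟨o₀, -⟩ := hne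
  obtain ⟨m, n, hmn, heq⟩ := Finite.exists_ne_map_eq_of_infinite fun n : ℕ => f^[n] o₀
  wlog hlt : m < n generalizing m n
  · exact this n m hmn.symm heq.symm (lt_of_le_of_ne (not_lt.1 hlt) hmn.symm)
  set o₁ := f^[m] o₀ with ho₁
  have hper : Function.IsPeriodicPt f (n - m) o₁ := by
    rw [Function.IsPeriodicPt, Function.IsFixedPt, ho₁, ← Function.iterate_add_apply,
      Nat.sub_add_cancel hlt.le]
    exact heq.symm
  have hmem : o₁ ∈ Function.periodicPts f := Function.mk_mem_periodicPts (by omega) hper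
  refine ⟨fun i => (f^[i] o₁).1, Function.minimalPeriod f o₁,
    Function.minimalPeriod_pos_of_mem_periodicPts hmem, fun i => (f^[i] o₁).2, fun i => ?_,
    fun i => ?_, fun k => ?_⟩
  · beta_reduce
    rw [Function.iterate_succ_apply']
    exact hf _
  · beta_reduce
    rw [Function.iterate_add_minimalPeriod_eq]
  · refine List.Nodup.map_on ?_ List.nodup_range
    intro x hx y hy hxy
    rw [List.mem_range] at hx hy
    have hinj : ∀ p q : O, p.1.1 = q.1.1 → p = q := by
      rintro ⟨⟨e, b⟩, hp⟩ ⟨⟨e', b'⟩, hq⟩ (rfl : e = e')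
      have := eq_of_bsign_mul_pos hp hq
      subst this
      rfl
    have h2 := hinj _ _ hxy
    rw [add_comm k x, add_comm k y, Function.iterate_add_apply, Function.iterate_add_apply] at h2
    have h3 : Function.minimalPeriod f (f^[k] o₁) = Function.minimalPeriod f o₁ :=
      Function.minimalPeriod_apply_iterate hmem k
    rw [← h3] at hx hy
    exact Function.iterate_injOn_Iio_minimalPeriod hx hy h2

/-- A closed path with nontrivial homology carries a simple closed path, connected to the base
point by a path which is short in comparison. -/
lemma exists_root [DecidableEq S] {w : FreeGroup S} (hw : π w = 1) (ha0 : ab (κ π w) ≠ 0) :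
    ∃ (u : FreeGroup S) (L : List (S × Bool)), L ≠ [] ∧
      ((edges π 1 L).map Prod.fst).Nodup ∧ π (FreeGroup.mk L) = 1 ∧
      (u * FreeGroup.mk L * u⁻¹).toWord.length ≤ w.toWord.length ∧
      ab (κ π (u * FreeGroup.mk L * u⁻¹)) ≠ 0 ∧
      ∀ e, ab (κ π (u * FreeGroup.mk L * u⁻¹)) e ≠ 0 →
        0 < ab (κ π (u * FreeGroup.mk L * u⁻¹)) e * ab (κ π w) e ∧
        |ab (κ π (u * FreeGroup.mk L * u⁻¹)) e| = 1 := by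
  classical
  set a := ab (κ π w) with ha
  have hbd := boundary_ab_sh_κ π 1 w
  rw [sh_one, hw, mul_one, sub_self] at hbd
  obtain ⟨o, j, hj, hpos, hchain, hper, hnodup⟩ := exists_cycle π ha0 hbd
  -- the simple closed path, based at any of its vertices
  have hcyc : ∀ (u : FreeGroup S) (k : ℕ), π u = src π (o k) →
      ∃ L : List (S × Bool), L.length = j ∧ ((edges π 1 L).map Prod.fst).Nodup ∧
        π (FreeGroup.mk L) = 1 ∧ ab (κ π (u * FreeGroup.mk L * u⁻¹)) ≠ 0 ∧
        ∀ e, ab (κ π (u * FreeGroup.mk L * u⁻¹)) e ≠ 0 →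
          0 < ab (κ π (u * FreeGroup.mk L * u⁻¹)) e * a e ∧
          |ab (κ π (u * FreeGroup.mk L * u⁻¹)) e| = 1 := by
    intro u k hu
    obtain ⟨h1, h2⟩ := edges_of_chain π (fun i => o (k + i)) (fun i => hchain (k + i)) j
    simp only [add_zero, hper, ← hu] at h1 h2
    set L := (List.range j).map fun i => ((o (k + i)).1.2, (o (k + i)).2)
    have h3 : π (FreeGroup.mk L) = 1 := by simpa using h2
    have h4 : ab (κ π (u * FreeGroup.mk L * u⁻¹)) =
        ab (FreeGroup.mk ((List.range j).map fun i => o (k + i))) := by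
      rw [κ_conj π h3, ab_mul, ab_mul, ab_inv, sh_κ_mk, h1]
      abel
    have h5 : (((List.range j).map fun i => o (k + i)).map Prod.fst).Nodup := by
      rw [List.map_map]
      exact hnodup k
    refine ⟨L, by simp [L], ?_, h3, ?_, ?_⟩
    · rw [← h1, ← mul_one (π u), map_fst_edges_mul] at h5
      exact h5.of_map _
    · intro h0
      have hmem : o (k + 0) ∈ (List.range j).map fun i => o (k + i) :=
        List.mem_map.2 ⟨0, List.mem_range.2 hj, rfl⟩
      have := ab_mk_apply_of_mem h5 hmem
      rw [← h4, h0] at this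
      exact bsign_ne_zero _ this.symm
    · rw [h4]
      intro e he
      have hmem : e ∈ ((List.range j).map fun i => o (k + i)).map Prod.fst := by
        by_contra h
        exact he (ab_mk_apply_of_notMem h)
      obtain ⟨p, hp, rfl⟩ := List.mem_map.1 hmem
      rw [ab_mk_apply_of_mem h5 hp]
      obtain ⟨i, -, rfl⟩ := List.mem_map.1 hp
      refine ⟨hpos _, ?_⟩
      cases (o (k + i)).2 <;> simp [bsign]
  -- the first and the last visit of the path of `w`
  let V : Set Q := Set.range fun k => src π (o k)
  have htgt : ∀ k, tgt π (o k) ∈ V := fun k => ⟨k + 1, hchain k⟩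
  have hV : ∀ k (p : (Q × S) × Bool), p.1 = (o k).1 → src π p ∈ V ∧ tgt π p ∈ V := by
    rintro k ⟨e, b⟩ (rfl : e = (o k).1)
    constructor
    · rcases src_eq_or_eq π (o k).1 b (o k).2 with h | h <;> rw [h]
      · exact ⟨k, rfl⟩
      · exact htgt k
    · rcases tgt_eq_or_eq π (o k).1 b (o k).2 with h | h <;> rw [h]
      · exact ⟨k, rfl⟩
      · exact htgt k
  have hedge : ∀ k, ∃ p ∈ edges π 1 w.toWord, p.1 = (o k).1 := by
    intro k
    have : (o k).1 ∈ (edges π 1 w.toWord).map Prod.fst := by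
      by_contra h
      have h0 := ab_mk_apply_of_notMem h
      rw [← sh_κ_mk, sh_one, FreeGroup.mk_toWord] at h0
      have := hpos k
      rw [ha, h0, mul_zero] at this
      exact lt_irrefl _ this
    exact List.mem_map.1 this
  let Hit : List (S × Bool) → List (S × Bool) → Prop :=
    fun A B => w.toWord = A ++ B ∧ π (FreeGroup.mk A) ∈ V
  have hhit : ∃ A B, Hit A B := by
    obtain ⟨p, hp, hpo⟩ := hedge 0
    obtain ⟨A, l, B, h1, h2, -⟩ := exists_split_of_mem_edges π hp
    rw [one_mul] at h2
    exact ⟨A, l :: B, h1, h2 ▸ (hV 0 p hpo).1⟩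
  obtain ⟨A₁, ⟨B₁, hA₁⟩, hmin₁⟩ : ∃ A, (∃ B, Hit A B) ∧ ∀ A' B', Hit A' B' →
      A.length ≤ A'.length := by
    obtain ⟨A, hA, hmin⟩ := WellFounded.has_min (measure (List.length (α := S × Bool))).wf
      {A | ∃ B, Hit A B} hhit
    exact ⟨A, hA, fun A' B' h => not_lt.1 (hmin A' ⟨B', h⟩)⟩
  obtain ⟨B₂, ⟨A₂, hA₂⟩, hmin₂⟩ : ∃ B, (∃ A, Hit A B) ∧ ∀ A' B', Hit A' B' →
      B.length ≤ B'.length := by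
    obtain ⟨B, hB, hmin⟩ := WellFounded.has_min (measure (List.length (α := S × Bool))).wf
      {B | ∃ A, Hit A B} (by obtain ⟨A, B, h⟩ := hhit; exact ⟨B, A, h⟩)
    exact ⟨B, hB, fun A' B' h => not_lt.1 (hmin B' ⟨A', h⟩)⟩
  obtain ⟨M, rfl⟩ : A₁ <+: A₂ := List.prefix_of_prefix_length_le
    ⟨B₁, hA₁.1.symm⟩ ⟨B₂, hA₂.1.symm⟩ (hmin₁ _ _ hA₂)
  have hM : j ≤ M.length := by
    have hsub : ((List.range j).map fun i => (o (0 + i)).1) ⊆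
        (edges π (1 * π (FreeGroup.mk A₁)) M).map Prod.fst := by
      intro e he
      obtain ⟨i, -, rfl⟩ := List.mem_map.1 he
      rw [zero_add]
      obtain ⟨p, hp, hpo⟩ := hedge i
      rw [hA₂.1, edges_append, edges_append, List.mem_append, List.mem_append] at hp
      rcases hp with (hp | hp) | hp
      · exfalso
        obtain ⟨A, l, B, h1, h2, -⟩ := exists_split_of_mem_edges π hp
        have := hmin₁ A (l :: B ++ (M ++ B₂)) ⟨by rw [hA₂.1, h1]; simp, by
          rw [one_mul] at h2
          exact h2 ▸ (hV i p hpo).1⟩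
        rw [h1] at this
        simp at this
      · exact List.mem_map.2 ⟨p, hp, hpo⟩
      · exfalso
        obtain ⟨A, l, B, h1, -, h2⟩ := exists_split_of_mem_edges π hp
        have := hmin₂ (A₁ ++ M ++ (A ++ [l])) B ⟨by rw [hA₂.1, h1]; simp, by
          rw [one_mul, ← map_mk_append] at h2
          exact h2 ▸ (hV i p hpo).2⟩
        rw [h1] at this
        simp at this
        omega
    have := ((hnodup 0).subperm hsub).length_le
    simpa [length_edges] using this
  have hlen : w.toWord.length = A₁.length + M.length + B₂.length := by
    rw [hA₂.1, List.length_append, List.length_append]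
  have hnorm : ∀ (P L : List (S × Bool)), L.length = j → 2 * P.length + j ≤ w.toWord.length →
      ∀ u : FreeGroup S, u = FreeGroup.mk P ∨ u = (FreeGroup.mk P)⁻¹ →
      (u * FreeGroup.mk L * u⁻¹).toWord.length ≤ w.toWord.length := by
    intro P L hL hP u hu
    have hu' : FreeGroup.norm u ≤ P.length := by
      rcases hu with rfl | rfl
      · exact FreeGroup.norm_mk_le
      · rw [FreeGroup.norm_inv_eq]
        exact FreeGroup.norm_mk_le
    have h1 := FreeGroup.norm_mul_le (u * FreeGroup.mk L) u⁻¹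
    have h2 := FreeGroup.norm_mul_le u (FreeGroup.mk L)
    have h3 : FreeGroup.norm (FreeGroup.mk L) ≤ L.length := FreeGroup.norm_mk_le
    rw [FreeGroup.norm_inv_eq] at h1
    change FreeGroup.norm _ ≤ _
    omega
  have hnil : ∀ L : List (S × Bool), L.length = j → L ≠ [] := by
    rintro L hL rfl
    simp at hL
    omega
  rcases le_total A₁.length B₂.length with hle | hle
  · obtain ⟨k, hk⟩ := hA₁.2
    obtain ⟨L, hL, h1, h2, h3⟩ := hcyc (FreeGroup.mk A₁) k hk.symm
    exact ⟨_, L, hnil L hL, h1, h2, hnorm A₁ L hL (by omega) _ (Or.inl rfl), h3⟩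
  · obtain ⟨k, hk⟩ := hA₂.2
    have hu : π (FreeGroup.mk B₂)⁻¹ = src π (o k) := by
      have hk' : src π (o k) = π (FreeGroup.mk (A₁ ++ M)) := hk
      rw [← FreeGroup.mk_toWord (x := w), hA₂.1, map_mk_append] at hw
      rw [hk', map_inv, inv_eq_of_mul_eq_one_left hw]
    obtain ⟨L, hL, h1, h2, h3⟩ := hcyc _ k hu
    exact ⟨_, L, hnil L hL, h1, h2, hnorm B₂ L hL (by omega) _ (Or.inr rfl), h3⟩

end Cycle

end RatDerived

namespace RatDerived

section Functoriality

variable {S Q Q' : Type*} [Group Q] [Group Q']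

lemma κ_comp (θ : Q →* Q') (π : FreeGroup S →* Q) (u : FreeGroup S) :
    κ (θ.comp π) u = FreeGroup.map (fun e => (θ e.1, e.2)) (κ π u) := by
  have h (q : Q) (v : FreeGroup (Q × S)) : FreeGroup.map (fun e => (θ e.1, e.2)) (sh q v) =
      sh (θ q) (FreeGroup.map (fun e => (θ e.1, e.2)) v) := by
    induction v using FreeGroup.induction_on with
    | C1 => simp
    | of t => simp
    | inv_of t h => simp
    | mul u v hu hv => rw [map_mul, map_mul, hu, hv, map_mul, map_mul]
  induction u using FreeGroup.induction_on with
  | C1 => simp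
  | of t => simp
  | inv_of t h' => rw [κ_inv, κ_inv, h, h', map_inv (FreeGroup.map _), MonoidHom.comp_apply, map_inv θ]
  | mul u v hu hv => rw [κ_mul, κ_mul, map_mul, hu, hv, h, MonoidHom.comp_apply]

lemma edges_comp (θ : Q →* Q') (π : FreeGroup S →* Q) (q : Q) (L : List (S × Bool)) :
    edges (θ.comp π) (θ q) L = (edges π q L).map fun o => ((θ o.1.1, o.1.2), o.2) := by
  induction L generalizing q with
  | nil => rfl
  | cons o L ih =>
    rcases o with ⟨t, _ | _⟩ <;> simp [edges, ← ih]

lemma nodup_edges_comp {θ : Q →* Q'} {π : FreeGroup S →* Q} {L : List (S × Bool)}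
    (h : ((edges π 1 L).map Prod.fst).Nodup)
    (hθ : Set.InjOn θ {q | ∃ s, (q, s) ∈ (edges π 1 L).map Prod.fst}) :
    ((edges (θ.comp π) 1 L).map Prod.fst).Nodup := by
  have h1 : (edges (θ.comp π) 1 L).map Prod.fst =
      ((edges π 1 L).map Prod.fst).map fun e => (θ e.1, e.2) := by
    rw [← map_one θ, edges_comp]
    simp
  rw [h1]
  refine h.map_on ?_
  rintro ⟨p, s⟩ hp ⟨q, t⟩ hq he
  obtain ⟨he, rfl⟩ := Prod.ext_iff.1 he
  exact Prod.ext (hθ ⟨s, hp⟩ ⟨_, hq⟩ he) rfl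

lemma ab_κ_pow (π : FreeGroup S →* Q) {u : FreeGroup S} (hu : π u = 1) (k : ℕ) :
    ab (κ π (u ^ k)) = (k : ℚ) • ab (κ π u) := by
  induction k with
  | zero => simp
  | succ k ih =>
    rw [pow_succ, κ_mul_of_mem π (by simp [hu]), ab_mul, ih]
    push_cast
    rw [add_smul, one_smul]

/-- If a power of `r` is trivial modulo `w` and the class of `r` is supported in that of `w`, the
two classes are proportional. -/
lemma exists_smul_eq_smul (π : FreeGroup S →* Q) (hQ : LocInd Q) {w r : FreeGroup S}
    (hw : π w = 1) (hr : π r = 1) {j : ℕ}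
    (hrj : r ^ j ∈ ⁅π.ker, π.ker⁆ ⊔ Subgroup.normalClosure {w})
    (hsupp : (ab (κ π r)).support ⊆ (ab (κ π w)).support) (hw0 : ab (κ π w) ≠ 0) :
    ∃ t : ℚ, (j : ℚ) • ab (κ π r) = t • ab (κ π w) := by
  have := hQ.uniqueProds
  obtain ⟨α, hα⟩ := exists_slice_eq_mul π hw hrj
  obtain ⟨s, hs⟩ : ∃ s, slice s (ab (κ π w)) ≠ 0 := by
    by_contra! h
    exact hw0 (slice_ext fun s => by rw [h, slice_zero])
  have hα1 := hQ.support_subset_one (α := α) hs (by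
    rw [← hα, ab_κ_pow π hr]
    intro q hq
    rw [Finsupp.mem_support_iff, coeff_slice] at hq ⊢
    refine Finsupp.mem_support_iff.1 (hsupp (Finsupp.mem_support_iff.2 fun h => hq ?_))
    simp [h])
  obtain ⟨t, ht⟩ := Finsupp.support_subset_singleton'.1 hα1
  have hα2 : α = MonoidAlgebra.single 1 t := by
    ext q
    rw [ht]
    rfl
  refine ⟨t, slice_ext fun s => ?_⟩
  rw [← ab_κ_pow π hr, hα, hα2, slice_smul]
  ext q
  simp

end Functoriality

section Approximation

variable {G : Type*} [Group G] {K : Subgroup G} [K.Normal]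

/-- The projection from the quotient by the intersection of the series. -/
def proj (K : Subgroup G) [K.Normal] (n : ℕ) : G ⧸ (⨅ i, pre K i) →* G ⧸ pre K n :=
  QuotientGroup.lift _ (QuotientGroup.mk' (pre K n)) fun g hg => by
    rw [QuotientGroup.ker_mk']
    exact Subgroup.mem_iInf.1 hg n

lemma eventually_injOn_proj (V : Finset (G ⧸ (⨅ i, pre K i))) :
    ∀ᶠ n in Filter.atTop, Set.InjOn (proj K n) V := by
  have h : ∀ p ∈ V, ∀ q ∈ V, ∀ᶠ n in Filter.atTop, proj K n p = proj K n q → p = q := by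
    intro p _ q _
    obtain ⟨g, rfl⟩ := QuotientGroup.mk_surjective p
    obtain ⟨h, rfl⟩ := QuotientGroup.mk_surjective q
    by_cases hgh : g⁻¹ * h ∈ ⨅ i, pre K i
    · exact Filter.Eventually.of_forall fun _ _ => QuotientGroup.eq.2 hgh
    · rw [Subgroup.mem_iInf] at hgh
      push Not at hgh
      obtain ⟨i, hi⟩ := hgh
      filter_upwards [Filter.eventually_ge_atTop i] with n hn he
      exact absurd (pre_antitone hn (QuotientGroup.eq.1 he)) hi
  filter_upwards [(Filter.eventually_all_finset V).2 fun p hp =>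
    (Filter.eventually_all_finset V).2 (h p hp)] with n hn p hp q hq he
  exact hn p hp q hq he

end Approximation

section OneRelator

variable {S : Type*} [DecidableEq S] (w : FreeGroup S)

theorem exists_iInf_pre_eq : ∃ (r : FreeGroup S) (k : ℕ),
    r.toWord.length ≤ w.toWord.length ∧ 1 ≤ k ∧
      (r ^ k)⁻¹ * w ∈ ⁅Subgroup.normalClosure {r}, Subgroup.normalClosure {r}⁆ ∧
      ⨅ i, pre (Subgroup.normalClosure {w}) i = Subgroup.normalClosure {r} := by
  classical
  set K := Subgroup.normalClosure {w} with hK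
  have hwK : w ∈ K := Subgroup.subset_normalClosure (Set.mem_singleton w)
  by_cases hcase : ∀ n, w ∈ ⁅pre K n, pre K n⁆
  · have hpre := pre_eq_of_pow_mem (w := w) (r := 1) (k := 1) (fun i => one_mem _)
      (fun i => by simpa using hcase i)
    have hbot : ⨅ i, pre K i = ⊥ := by
      rw [← iInf_pre_one]
      exact iInf_congr fun i => (hpre i).symm
    have hw1 : w = 1 := by
      rw [← Subgroup.mem_bot, ← hbot]
      exact Subgroup.mem_iInf.2 fun i => le_pre i hwK
    refine ⟨1, 1, by simp, le_rfl, by simp [hw1], ?_⟩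
    rw [hbot]
    exact (le_bot_iff.1 (Subgroup.normalClosure_le_normal (by simp))).symm
  push Not at hcase
  obtain ⟨n₀, hn₀⟩ := hcase
  set π := QuotientGroup.mk' (⨅ i, pre K i) with hπ
  have hπker : π.ker = ⨅ i, pre K i := QuotientGroup.ker_mk' _
  have hπs : Function.Surjective π := QuotientGroup.mk'_surjective _
  have hw : π w = 1 := by
    rw [← MonoidHom.mem_ker, hπker]
    exact Subgroup.mem_iInf.2 fun i => le_pre i hwK
  have ha0 : ab (κ π w) ≠ 0 := by
    intro h
    refine hn₀ (Subgroup.commutator_mono ?_ ?_ (mem_commutator_ker π hπs hw h)) <;>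
    · rw [hπker]
      exact iInf_le _ n₀
  obtain ⟨u, L, hL, hnodup, hL1, hlen, hz0, hz⟩ := exists_root π hw ha0
  set r := u * FreeGroup.mk L * u⁻¹ with hr
  have hr1 : π r = 1 := by simp [hr, hL1]
  have hrpre (i : ℕ) : r ∈ pre K i := by
    rw [← MonoidHom.mem_ker, hπker] at hr1
    exact Subgroup.mem_iInf.1 hr1 i
  let V : Finset (FreeGroup S ⧸ (⨅ i, pre K i)) :=
    (ab (κ π w)).support.image Prod.fst ∪
      ((edges π 1 L).map Prod.fst).toFinset.image Prod.fst
  obtain ⟨n, hn, hinj⟩ := ((Filter.eventually_ge_atTop n₀).and (eventually_injOn_proj V)).exists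
  have hsupp : (ab (κ π r)).support ⊆ (ab (κ π w)).support := by
    intro e he
    rw [Finsupp.mem_support_iff] at he ⊢
    exact right_ne_zero_of_mul (hz e he).1.ne'
  set ψ := QuotientGroup.mk' (pre K n) with hψ
  have hψker : ψ.ker = pre K n := QuotientGroup.ker_mk' _
  have hψs : Function.Surjective ψ := QuotientGroup.mk'_surjective _
  have hLψ : ((edges ψ 1 L).map Prod.fst).Nodup := by
    refine nodup_edges_comp (θ := proj K n) hnodup (hinj.mono ?_)
    rintro q ⟨s, hq⟩
    exact Finset.mem_coe.2 (Finset.mem_union_right _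
      (Finset.mem_image.2 ⟨(q, s), List.mem_toFinset.2 hq, rfl⟩))
  let Θ : (FreeGroup S ⧸ (⨅ i, pre K i)) × S → (FreeGroup S ⧸ pre K n) × S :=
    fun e => (proj K n e.1, e.2)
  have hΘ : Set.InjOn Θ (ab (κ π w)).support := by
    rintro ⟨p, s⟩ hp ⟨q, t⟩ hq he
    obtain ⟨he, rfl⟩ := Prod.ext_iff.1 he
    have hV {e} (he : e ∈ (ab (κ π w)).support) : e.1 ∈ V :=
      Finset.mem_union_left _ (Finset.mem_image_of_mem _ he)
    exact Prod.ext (hinj (hV hp) (hV hq) he) rfl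
  have hmap (v : FreeGroup S) : ab (κ ψ v) = Finsupp.mapDomain Θ (ab (κ π v)) := by
    rw [← ab_map, ← κ_comp]
    rfl
  have hwψ : ψ w = 1 := by
    rw [← MonoidHom.mem_ker, hψker]
    exact le_pre n hwK
  have hrψ : ψ r = 1 := by
    rw [← MonoidHom.mem_ker, hψker]
    exact hrpre n
  have ha0ψ : ab (κ ψ w) ≠ 0 := by
    intro h
    refine hn₀ (Subgroup.commutator_mono ?_ ?_ (mem_commutator_ker ψ hψs hwψ h)) <;>
    · rw [hψker]
      exact pre_antitone hn
  have hsuppψ : (ab (κ ψ r)).support ⊆ (ab (κ ψ w)).support := by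
    rw [hmap, hmap, Finsupp.mapDomain_support_of_injOn _ hΘ]
    exact Finsupp.mapDomain_support.trans (Finset.image_subset_image hsupp)
  obtain ⟨-, j, hj, hrj⟩ := mem_pre_succ.1 (hrpre (n + 1))
  obtain ⟨t, ht⟩ := exists_smul_eq_smul ψ (locInd_of_pre K n) hwψ hrψ (by rwa [hψker])
    hsuppψ ha0ψ
  have hjt : (j : ℚ) • ab (κ π r) = t • ab (κ π w) := by
    refine Finsupp.mapDomain_injOn (S := ((ab (κ π w)).support : Set _)) hΘ ?_ ?_ ?_
    · exact Finsupp.support_smul.trans hsupp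
    · exact Finsupp.support_smul
    · rw [Finsupp.mapDomain_smul, Finsupp.mapDomain_smul, ← hmap, ← hmap, ht]
  obtain ⟨k, hk, hak⟩ : ∃ k : ℕ, 1 ≤ k ∧ ab (κ π w) = (k : ℚ) • ab (κ π r) := by
    obtain ⟨e, he⟩ := Finsupp.ne_iff.1 hz0
    rw [Finsupp.zero_apply] at he
    obtain ⟨hpos, habs⟩ := hz e he
    obtain ⟨c, hc⟩ := exists_int_ab (κ π w) e
    obtain ⟨d, hd⟩ := exists_int_ab (κ π r) e
    have hdc : 0 < d * c := by
      rw [hc, hd] at hpos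
      exact_mod_cast hpos
    have hj0 : (j : ℚ) ≠ 0 := Nat.cast_ne_zero.2 (by omega)
    have hsq : ab (κ π r) e * ab (κ π r) e = 1 := by
      rw [← abs_mul_abs_self, habs, one_mul]
    have hje : (j : ℚ) * ab (κ π r) e = t * ab (κ π w) e := DFunLike.congr_fun hjt e
    have ht0 : t ≠ 0 := by
      rintro rfl
      rw [zero_mul] at hje
      exact mul_ne_zero hj0 he hje
    have hcast : (((d * c).toNat : ℕ) : ℚ) = ab (κ π r) e * ab (κ π w) e := by
      rw [hc, hd, ← Int.cast_natCast, Int.toNat_of_nonneg hdc.le, Int.cast_mul]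
    refine ⟨(d * c).toNat, by omega, smul_right_injective _ ht0 ?_⟩
    change t • ab (κ π w) = t • _
    rw [← hjt, smul_smul, hcast]
    congr 1
    linear_combination (-(j : ℚ)) * hsq + ab (κ π r) e * hje
  have hmem : (r ^ k)⁻¹ * w ∈ ⁅⨅ i, pre K i, ⨅ i, pre K i⁆ := by
    rw [← hπker]
    refine mem_commutator_ker π hπs (by simp [hr1, hw]) ?_
    rw [κ_mul_of_mem π (by simp [hr1]), κ_inv, map_pow, hr1, one_pow, inv_one, sh_one, ab_mul,
      ab_inv, ab_κ_pow π hr1, hak, neg_add_cancel]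
  have hpre := pre_eq_of_pow_mem hrpre (k := k)
    fun i => Subgroup.commutator_mono (iInf_le _ i) (iInf_le _ i) hmem
  have hrL : Subgroup.normalClosure {r} = Subgroup.normalClosure {FreeGroup.mk L} := by
    refine le_antisymm (Subgroup.normalClosure_le_normal ?_) (Subgroup.normalClosure_le_normal ?_)
    · exact Set.singleton_subset_iff.2 (Subgroup.normalClosure_normal.conj_mem _
        (Subgroup.subset_normalClosure (Set.mem_singleton _)) u)
    · have := Subgroup.normalClosure_normal.conj_mem _
        (Subgroup.subset_normalClosure (Set.mem_singleton r)) u⁻¹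
      simpa [hr, mul_assoc] using this
  have homega : ⨅ i, pre K i = Subgroup.normalClosure {r} := by
    rw [← iInf_congr hpre]
    simp only [hrL]
    refine iInf_pre_eq_normalClosure ψ (locInd_of_pre K n) hψs hL hLψ ?_ (n := n) ?_
    · simpa [hr] using hrψ
    · rw [hψker, ← hpre n]
      simp only [hrL]
  exact ⟨r, k, hlen, hk, homega ▸ hmem, homega⟩

end OneRelator

end RatDerived

namespace RatDerived

section Perfect

variable {G : Type*} [Group G]

lemma ratDerivedOmega_quotient (K : Subgroup G) [K.Normal] :
    ratDerivedOmega (G ⧸ K) = (⨅ i, pre K i).map (QuotientGroup.mk' K) := by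
  have h : (ratDerivedOmega (G ⧸ K)).comap (QuotientGroup.mk' K) = ⨅ i, pre K i :=
    Subgroup.comap_iInf _ _
  rw [← h, Subgroup.map_comap_eq_self_of_surjective (QuotientGroup.mk'_surjective K)]

/-- A subgroup is rationally perfect if each of its elements has a power in its commutator. -/
lemma ratDerived_one_eq_top {H : Subgroup G}
    (h : ∀ x ∈ H, ∃ k : ℕ, 1 ≤ k ∧ x ^ k ∈ ⁅H, H⁆) : ratDerived H 1 = ⊤ := by
  rw [eq_top_iff]
  rintro ⟨x, hx⟩ -
  obtain ⟨k, hk, hxk⟩ := h x hx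
  refine mem_ratDerived_succ.2 ⟨Subgroup.mem_top _, k, hk, ?_⟩
  have hmap : Subgroup.map H.subtype ⁅(⊤ : Subgroup H), (⊤ : Subgroup H)⁆ = ⁅H, H⁆ := by
    rw [Subgroup.map_commutator, ← MonoidHom.range_eq_map, Subgroup.range_subtype]
  rw [← hmap] at hxk
  obtain ⟨y, hy, hyx⟩ := hxk
  have : y = ⟨x, hx⟩ ^ k := Subtype.ext hyx
  exact this ▸ hy

lemma exists_pow_mem_commutator {w r : G} {k : ℕ} (hk : 1 ≤ k)
    (h : (r ^ k)⁻¹ * w ∈ ⁅Subgroup.normalClosure {r}, Subgroup.normalClosure {r}⁆)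
    {x : G ⧸ Subgroup.normalClosure {w}} (hx : x ∈ (Subgroup.normalClosure {r}).map
      (QuotientGroup.mk' (Subgroup.normalClosure {w}))) :
    ∃ j : ℕ, 1 ≤ j ∧ x ^ j ∈
      ⁅(Subgroup.normalClosure {r}).map (QuotientGroup.mk' (Subgroup.normalClosure {w})),
        (Subgroup.normalClosure {r}).map (QuotientGroup.mk' (Subgroup.normalClosure {w}))⁆ := by
  obtain ⟨y, hy, rfl⟩ := hx
  set R := Subgroup.normalClosure {r}
  have hle : R ≤ isolator R (⁅R, R⁆ ⊔ Subgroup.normalClosure {w}) le_sup_left := by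
    refine Subgroup.normalClosure_le_normal (Set.singleton_subset_iff.2
      ⟨Subgroup.subset_normalClosure (Set.mem_singleton r), k, hk, ?_⟩)
    have hrk : r ^ k = w * ((r ^ k)⁻¹ * w)⁻¹ := by group
    rw [hrk]
    exact mul_mem (Subgroup.mem_sup_right (Subgroup.subset_normalClosure (Set.mem_singleton w)))
      (inv_mem (Subgroup.mem_sup_left h))
  obtain ⟨-, j, hj, hyj⟩ := hle hy
  refine ⟨j, hj, ?_⟩
  have := Subgroup.mem_map_of_mem (QuotientGroup.mk' (Subgroup.normalClosure {w})) hyj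
  rwa [Subgroup.map_sup, QuotientGroup.map_mk'_self, sup_bot_eq, Subgroup.map_commutator,
    map_pow] at this

end Perfect

end RatDerived

/-- For any word `w` in a free group `F`, there are `r ∈ F` of reduced
length at most that of `w` and `k ≥ 1` with `w ∈ r^k·[⟪r⟫,⟪r⟫]`, such that the ω-th term of
the rational derived series of the one-relator group `G = F/⟪w⟫` is the normal closure of the
image of `r`, and this subgroup is rationally perfect. -/
theorem ratDerivedOmega_oneRelator {S : Type*} [DecidableEq S] (w : FreeGroup S) :
    ∃ (r : FreeGroup S) (k : ℕ),
      r.toWord.length ≤ w.toWord.length ∧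
      1 ≤ k ∧
      (r ^ k)⁻¹ * w ∈ ⁅Subgroup.normalClosure {r}, Subgroup.normalClosure {r}⁆ ∧
      ratDerivedOmega (FreeGroup S ⧸ Subgroup.normalClosure {w}) =
        Subgroup.normalClosure
          {(QuotientGroup.mk r : FreeGroup S ⧸ Subgroup.normalClosure {w})} ∧
      ratDerived (↥(ratDerivedOmega (FreeGroup S ⧸ Subgroup.normalClosure {w}))) 1 = ⊤ := by
  obtain ⟨r, k, hlen, hk, hmem, homega⟩ := RatDerived.exists_iInf_pre_eq w
  have h : ratDerivedOmega (FreeGroup S ⧸ Subgroup.normalClosure {w}) =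
      (Subgroup.normalClosure {r}).map (QuotientGroup.mk' (Subgroup.normalClosure {w})) := by
    rw [RatDerived.ratDerivedOmega_quotient, homega]
  refine ⟨r, k, hlen, hk, hmem, ?_, RatDerived.ratDerived_one_eq_top fun x hx => ?_⟩
  · rw [h, Subgroup.map_normalClosure _ _ (QuotientGroup.mk'_surjective _), Set.image_singleton]
    rfl
  · rw [h] at hx ⊢
    exact RatDerived.exists_pow_mem_commutator hk hmem hx
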